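/- Let χ be a non-principal Dirichlet character and assume GRH for χ, χχ₋₄, χ² and χ²χ₋₄. Fix c ∈ (0,1/8) and ε > 0. Then there is a constant C = C(χ, c, ε) such that for every non-trivial zero ρ = 1/2 + iγ ≠ 1/2 of L(s,χ)L(s,χχ₋₄), every x ≥ 2 and every sufficiently small r ∈ (0,1), ∫_{H_ρ} |F(s,χ)| |x^s| |ds| ≤ C √x (|γ| + 1)^{c+ε} ((log x)^{−3/2} + r^{3/2} x^r). -/

import Mathlib

open Complex Filter
open scoped Classical

noncomputable section

/-- `n` is a sum of two squares. -/
def IsSum2Sq (n : ℕ) : Prop := ∃ a b : ℕ, n = a ^ 2 + b ^ 2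

/-- The Dirichlet L-function `L(s,χ)` (junk value `0` if the modulus is `0`). -/
noncomputable def LVal {N : ℕ} (χ : DirichletCharacter ℂ N) (s : ℂ) : ℂ :=
  if h : N = 0 then 0 else
    haveI : NeZero N := ⟨h⟩
    DirichletCharacter.LFunction χ s

/-- GRH for `L(s,χ)`: all zeros with `0 < Re s < 1` have real part `1/2`. -/
def GRH {N : ℕ} (χ : DirichletCharacter ℂ N) : Prop :=
  ∀ s : ℂ, 0 < s.re → s.re < 1 → LVal χ s = 0 → s.re = 1 / 2

/-- The unique non-principal Dirichlet character modulo 4. -/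
noncomputable def chiNeg4 : DirichletCharacter ℂ 4 := ZMod.χ₄.ringHomComp (Int.castRingHom ℂ)

/-- The product `χ ⋅ χ₋₄`, as a Dirichlet character modulo `4q`. -/
noncomputable def mulChiNeg4 {q : ℕ} (χ : DirichletCharacter ℂ q) : DirichletCharacter ℂ (4 * q) :=
  DirichletCharacter.changeLevel (dvd_mul_left q 4) χ *
    DirichletCharacter.changeLevel (dvd_mul_right 4 q) chiNeg4

/-- `S(x;q,a)`, the number of sums of two squares `n ≤ x` with `n ≡ a (mod q)`. -/
noncomputable def Scount (q a : ℕ) (x : ℝ) : ℕ :=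
  ((Finset.Icc 1 ⌊x⌋₊).filter (fun m => IsSum2Sq m ∧ (m : ZMod q) = (a : ZMod q))).card

/-- The sequence `n ↦ 1_S(n) χ(n)`. -/
noncomputable def STwist {q : ℕ} (χ : DirichletCharacter ℂ q) (n : ℕ) : ℂ :=
  if IsSum2Sq n then χ (n : ZMod q) else 0

/-- `∑_{n ≤ x, n ∈ S} χ(n)`. -/
noncomputable def SSum {q : ℕ} (χ : DirichletCharacter ℂ q) (x : ℝ) : ℂ :=
  ∑ n ∈ Finset.Icc 1 ⌊x⌋₊, STwist χ n

/-- A set of positive integers has natural density one. -/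
def HasDensityOne (P : ℕ → Prop) : Prop :=
  Tendsto (fun n : ℕ => (((Finset.Icc 1 n).filter P).card : ℝ) / n) atTop (nhds 1)

/-- The integral of `f` over the truncated Hankel contour around `ρ`, with horizontal extent
`c` and radius `r`; the two horizontal segments are taken as boundary values from below
(lower segment, traversed rightwards, `arg(s-ρ) = -π`) and from above (upper segment,
traversed leftwards, `arg(s-ρ) = π`), and the circle `|s-ρ| = r` is traversed
anticlockwise. -/
noncomputable def hankelIntegral (f : ℂ → ℂ) (ρ : ℂ) (c r : ℝ) : ℂ :=
  limUnder (nhdsWithin (0 : ℝ) (Set.Ioi 0)) (fun ε =>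
    ((∫ σ in (ρ.re - c)..(ρ.re - r), f (σ + (ρ.im - ε) * I))
      + ∫ θ in (-Real.pi)..Real.pi, f (ρ + r * Complex.exp (θ * I)) * (I * r * Complex.exp (θ * I)))
      - ∫ σ in (ρ.re - c)..(ρ.re - r), f (σ + (ρ.im + ε) * I))

/-- The integral `∫ g(s) |ds|` of a nonnegative density `g` over the truncated Hankel
contour around `ρ` (horizontal extent `c`, radius `r`), horizontal segments again taken
as boundary values from below resp. above. -/
noncomputable def hankelAbsIntegral (g : ℂ → ℝ) (ρ : ℂ) (c r : ℝ) : ℝ :=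
  limUnder (nhdsWithin (0 : ℝ) (Set.Ioi 0)) (fun ε =>
    (∫ σ in (ρ.re - c)..(ρ.re - r), g (σ + (ρ.im - ε) * I))
      + (∫ θ in (-Real.pi)..Real.pi, g (ρ + r * Complex.exp (θ * I)) * r)
      + ∫ σ in (ρ.re - c)..(ρ.re - r), g (σ + (ρ.im + ε) * I))

/-- The constant `C_q` of the paper. -/
noncomputable def Cconst (q : ℕ) : ℝ :=
  (2 * Real.pi ^ (-(1 / 4 : ℝ)) / Real.Gamma (1 / 4)) *
    (∏' p : Nat.Primes, if (p : ℕ) % 4 = 3 then (1 - (p : ℝ) ^ (-(2:ℝ))) ^ (-(1 / 4 : ℝ)) else 1) *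
    ∏ p ∈ q.primeFactors.filter (fun p => p % 4 = 3), (1 - 1 / (p : ℝ)) ^ ((1 : ℝ) / 2)

/-- Convexity bound in a vertical strip: an entire function of at most exponential growth in a
strip whose boundary values grow polynomially has interpolated polynomial growth inside. -/
lemma exists_norm_le_of_verticalStrip {f : ℂ → ℂ} {a b α β A B K : ℝ} (hab : a < b)
    (hf : Differentiable ℂ f) (hα : 0 ≤ α) (hβ : 0 ≤ β) (hK : 0 ≤ K)
    (hfK : ∀ s : ℂ, a ≤ s.re → s.re ≤ b → ‖f s‖ ≤ K * Real.exp (K * |s.im|))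
    (ha : ∀ s : ℂ, s.re = a → ‖f s‖ ≤ A * (1 + |s.im|) ^ α)
    (hb : ∀ s : ℂ, s.re = b → ‖f s‖ ≤ B * (1 + |s.im|) ^ β) :
    ∃ C : ℝ, 0 < C ∧ ∀ s : ℂ, a ≤ s.re → s.re ≤ b →
      ‖f s‖ ≤ C * (1 + |s.im|) ^ (α * (1 - (s.re - a) / (b - a)) + β * ((s.re - a) / (b - a))) := by
  have hA0 : 0 ≤ A := by
    have h := (norm_nonneg _).trans (ha (a : ℂ) (by simp))
    simpa using h
  have hB0 : 0 ≤ B := by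
    have h := (norm_nonneg _).trans (hb (b : ℂ) (by simp))
    simpa using h
  set D := b - a with hD
  have hDpos : 0 < D := sub_pos.2 hab
  -- the Gaussian localisation
  have gauss : ∀ s w : ℂ, a ≤ s.re → s.re ≤ b → a ≤ w.re → w.re ≤ b →
      ‖exp ((w - s) ^ 2)‖ ≤ Real.exp (D ^ 2 - |w.im - s.im| ^ 2) := by
    intro s w h1 h2 h3 h4
    rw [norm_exp, Real.exp_le_exp]
    simp only [sq, mul_re, sub_re, sub_im]
    rw [abs_mul_abs_self]
    nlinarith
  have absb : ∀ k v : ℝ, k * v - v ^ 2 ≤ k ^ 2 / 4 := by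
    intro k v; nlinarith [sq_nonneg (v - k / 2)]
  have edge : ∀ (k M : ℝ), 0 ≤ k → 0 ≤ M → ∀ s w : ℂ, a ≤ s.re → s.re ≤ b → a ≤ w.re → w.re ≤ b →
      ‖f w‖ ≤ M * (1 + |w.im|) ^ k →
      ‖f w * exp ((w - s) ^ 2)‖ ≤ M * Real.exp (D ^ 2 + k ^ 2 / 4) * (1 + |s.im|) ^ k := by
    intro k M hk hM s w h1 h2 h3 h4 hw
    rw [norm_mul]
    have hv : 0 ≤ |w.im - s.im| := abs_nonneg _
    have h5 : (1 + |w.im|) ^ k ≤ (1 + |s.im|) ^ k * Real.exp (k * |w.im - s.im|) := by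
      have e1 : 1 + |w.im| ≤ (1 + |s.im|) * (1 + |w.im - s.im|) := by
        have : |w.im| ≤ |w.im - s.im| + |s.im| := by
          simpa using abs_add_le (w.im - s.im) s.im
        nlinarith [abs_nonneg s.im]
      calc (1 + |w.im|) ^ k ≤ ((1 + |s.im|) * (1 + |w.im - s.im|)) ^ k :=
            Real.rpow_le_rpow (by positivity) e1 hk
        _ = (1 + |s.im|) ^ k * (1 + |w.im - s.im|) ^ k :=
            Real.mul_rpow (by positivity) (by positivity)
        _ ≤ (1 + |s.im|) ^ k * Real.exp (|w.im - s.im|) ^ k := by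
            gcongr
            rw [add_comm]; exact Real.add_one_le_exp _
        _ = _ := by rw [← Real.exp_mul, mul_comm k]
    calc ‖f w‖ * ‖exp ((w - s) ^ 2)‖
        ≤ (M * ((1 + |s.im|) ^ k * Real.exp (k * |w.im - s.im|))) *
          Real.exp (D ^ 2 - |w.im - s.im| ^ 2) := by
          gcongr
          · exact hw.trans (by gcongr)
          · exact gauss s w h1 h2 h3 h4
      _ = M * Real.exp (D ^ 2 + (k * |w.im - s.im| - |w.im - s.im| ^ 2)) * (1 + |s.im|) ^ k := by
          rw [show D ^ 2 + (k * |w.im - s.im| - |w.im - s.im| ^ 2) =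
            k * |w.im - s.im| + (D ^ 2 - |w.im - s.im| ^ 2) by ring, Real.exp_add]
          ring
      _ ≤ _ := by gcongr; exact absb _ _
  set A' := A * Real.exp (D ^ 2 + α ^ 2 / 4) + 1 with hA'
  set B' := B * Real.exp (D ^ 2 + β ^ 2 / 4) + 1 with hB'
  have hA'1 : 1 ≤ A' := by rw [hA']; nlinarith [Real.exp_pos (D ^ 2 + α ^ 2 / 4)]
  have hB'1 : 1 ≤ B' := by rw [hB']; nlinarith [Real.exp_pos (D ^ 2 + β ^ 2 / 4)]
  refine ⟨A' * B', by positivity, fun s hs1 hs2 => ?_⟩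
  have hT : 1 ≤ 1 + |s.im| := by linarith [abs_nonneg s.im]
  set θ := (s.re - a) / D with hθ
  have hθ0 : 0 ≤ θ := div_nonneg (by linarith) hDpos.le
  have hθ1 : θ ≤ 1 := by rw [hθ, div_le_one hDpos]; linarith
  have key := HadamardThreeLines.norm_le_interp_of_mem_verticalClosedStrip'
    (f := fun w => f w * exp ((w - s) ^ 2)) (z := s) (a := A' * (1 + |s.im|) ^ α)
    (b := B' * (1 + |s.im|) ^ β) hab ⟨hs1, hs2⟩ (by
      apply Differentiable.diffContOnCl
      fun_prop) (by
      refine ⟨K * Real.exp (K * |s.im| + D ^ 2 + K ^ 2 / 4), ?_⟩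
      rintro _ ⟨w, ⟨hw1, hw2⟩, rfl⟩
      simp only [Function.comp, norm_mul]
      have e1 : |w.im| ≤ |w.im - s.im| + |s.im| := by
        simpa using abs_add_le (w.im - s.im) s.im
      calc ‖f w‖ * ‖exp ((w - s) ^ 2)‖
          ≤ K * Real.exp (K * |w.im|) * Real.exp (D ^ 2 - |w.im - s.im| ^ 2) := by
            gcongr
            · exact hfK w hw1 hw2
            · exact gauss s w hs1 hs2 hw1 hw2
        _ = K * Real.exp (K * |w.im| + (D ^ 2 - |w.im - s.im| ^ 2)) := by
            rw [Real.exp_add]; ring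
        _ ≤ _ := by
            refine mul_le_mul_of_nonneg_left (Real.exp_le_exp.2 ?_) hK
            nlinarith [absb K |w.im - s.im|, mul_le_mul_of_nonneg_left e1 hK])
    (by
      intro w hw
      have hw' : w.re = a := hw
      refine (edge α A hα hA0 s w hs1 hs2 hw'.ge (by linarith) (ha w hw')).trans ?_
      gcongr
      linarith)
    (by
      intro w hw
      have hw' : w.re = b := hw
      refine (edge β B hβ hB0 s w hs1 hs2 (by linarith) hw'.le (hb w hw')).trans ?_
      gcongr
      linarith)
  simp only [sub_self, ne_eq, OfNat.ofNat_ne_zero, not_false_eq_true, zero_pow, exp_zero,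
    mul_one] at key
  rw [← hD, ← hθ] at key
  refine key.trans ?_
  rw [Real.mul_rpow (by positivity) (by positivity), Real.mul_rpow (by positivity) (by positivity),
    ← Real.rpow_mul (by positivity), ← Real.rpow_mul (by positivity),
    Real.rpow_add (by positivity)]
  calc A' ^ (1 - θ) * (1 + |s.im|) ^ (α * (1 - θ)) * (B' ^ θ * (1 + |s.im|) ^ (β * θ))
      ≤ A' ^ (1 : ℝ) * (1 + |s.im|) ^ (α * (1 - θ)) * (B' ^ (1 : ℝ) * (1 + |s.im|) ^ (β * θ)) := by
        gcongr; linarith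
    _ = _ := by rw [Real.rpow_one, Real.rpow_one]; ring

/-- A non-vanishing holomorphic function on a disc has a holomorphic logarithm, normalised at the
centre by the principal branch. -/
lemma exists_log_on_ball {f : ℂ → ℂ} {c : ℂ} {R : ℝ} (hR : 0 < R)
    (hf : DifferentiableOn ℂ f (Metric.ball c R)) (h0 : ∀ z ∈ Metric.ball c R, f z ≠ 0) :
    ∃ g : ℂ → ℂ, DifferentiableOn ℂ g (Metric.ball c R) ∧ g c = log (f c) ∧
      ∀ z ∈ Metric.ball c R, exp (g z) = f z := by
  have hc : c ∈ Metric.ball c R := Metric.mem_ball_self hR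
  have hd : DifferentiableOn ℂ (fun z => deriv f z / f z) (Metric.ball c R) :=
    (hf.deriv Metric.isOpen_ball).div hf h0
  obtain ⟨h, hh⟩ := hd.isExactOn_ball
  have hconst : ∀ z ∈ Metric.ball c R, f z * exp (-h z) = f c * exp (-h c) := by
    intro z hz
    have hder : ∀ w ∈ Metric.ball c R, HasDerivAt (fun z => f z * exp (-h z)) 0 w := by
      intro w hw
      have h1 := (hf.differentiableAt (Metric.isOpen_ball.mem_nhds hw)).hasDerivAt
      have h2 := h1.mul ((hh w hw).neg.cexp)
      refine h2.congr_deriv ?_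
      have := h0 w hw
      simp only [Pi.neg_apply]
      field_simp
      ring
    exact Metric.isOpen_ball.is_const_of_deriv_eq_zero (convex_ball c R).isPreconnected
      (fun w hw => (hder w hw).differentiableAt.differentiableWithinAt)
      (fun w hw => (hder w hw).deriv) hz hc
  refine ⟨fun z => h z - h c + log (f c), ?_, by simp, fun z hz => ?_⟩
  · intro z hz
    exact (((hh z hz).differentiableAt.sub_const _).add_const _).differentiableWithinAt
  · have e := hconst z hz
    rw [exp_add, exp_sub, exp_log (h0 c hc)]
    rw [exp_neg, exp_neg] at e
    field_simp at e ⊢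
    linear_combination -e

/-- Taylor expansion bound combining a good bound on a small disc and a weak bound on a
large disc. -/
lemma norm_le_of_two_discs {g : ℂ → ℂ} {c z : ℂ} {r₁ r ρ R P Q : ℝ} (N : ℕ) (hr₁ : 0 < r₁)
    (hr₁R : r₁ < R) (hr : 0 ≤ r) (hrρ : r < ρ) (hρR : ρ < R)
    (hg : DifferentiableOn ℂ g (Metric.ball c R))
    (hP : ∀ w, ‖w - c‖ = ρ → ‖g w‖ ≤ P) (hQ : ∀ w, ‖w - c‖ = r₁ → ‖g w‖ ≤ Q)
    (hz : ‖z - c‖ ≤ r) :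
    ‖g z‖ ≤ (∑ n ∈ Finset.range N, Q * (r / r₁) ^ n) + P * (r / ρ) ^ N * (1 - r / ρ)⁻¹ := by
  have hρ : 0 < ρ := hr.trans_lt hrρ
  have hzR : z ∈ Metric.ball c R := by
    rw [mem_ball_iff_norm]; linarith
  have hs := hasSum_taylorSeries_on_ball hg hzR
  set t : ℕ → ℂ := fun n => ((n.factorial : ℂ))⁻¹ • (z - c) ^ n • iteratedDeriv n g c with ht
  have coef : ∀ (u S : ℝ), 0 < u → u < R → (∀ w, ‖w - c‖ = u → ‖g w‖ ≤ S) → ∀ n,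
      ‖t n‖ ≤ S * (r / u) ^ n := by
    intro u S hu huR hS n
    have hdc : DiffContOnCl ℂ g (Metric.ball c u) :=
      DifferentiableOn.diffContOnCl (hg.mono
        (Metric.closure_ball_subset_closedBall.trans (Metric.closedBall_subset_ball huR)))
    have h := norm_iteratedDeriv_le_of_forall_mem_sphere_norm_le n hu hdc (C := S)
      (fun w hw => hS w (by rwa [mem_sphere_iff_norm] at hw))
    have hS0 : 0 ≤ S := by
      refine (norm_nonneg _).trans (hS (c + u) ?_)
      simp [abs_of_pos hu]
    have hn : (0 : ℝ) < n.factorial := by exact_mod_cast n.factorial_pos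
    simp only [ht, norm_smul, norm_inv, norm_pow, RCLike.norm_natCast]
    calc (n.factorial : ℝ)⁻¹ * (‖z - c‖ ^ n * ‖iteratedDeriv n g c‖)
        ≤ (n.factorial : ℝ)⁻¹ * (r ^ n * (n.factorial * S / u ^ n)) := by gcongr
      _ = S * (r / u) ^ n := by
        rw [div_pow]; field_simp
  have hx0 : 0 ≤ r / ρ := div_nonneg hr hρ.le
  have hx1 : r / ρ < 1 := (div_lt_one hρ).2 hrρ
  have h2 := (hasSum_nat_add_iff' N).2 hs
  have htail : ‖g z - ∑ i ∈ Finset.range N, t i‖ ≤ P * (r / ρ) ^ N * (1 - r / ρ)⁻¹ := by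
    rw [← h2.tsum_eq]
    refine tsum_of_norm_bounded ((hasSum_geometric_of_lt_one hx0 hx1).mul_left _) (fun n => ?_)
    refine (coef ρ P hρ hρR hP (n + N)).trans (le_of_eq ?_)
    rw [pow_add]; ring
  have hhead : ‖∑ i ∈ Finset.range N, t i‖ ≤ ∑ n ∈ Finset.range N, Q * (r / r₁) ^ n :=
    norm_sum_le_of_le _ (fun n _ => coef r₁ Q hr₁ hr₁R hQ n)
  calc ‖g z‖ = ‖(∑ i ∈ Finset.range N, t i) + (g z - ∑ i ∈ Finset.range N, t i)‖ := by
        congr 1; ring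
    _ ≤ _ := (norm_add_le _ _).trans (add_le_add hhead htail)

/-- If a zero-free holomorphic function on a disc of radius `R` is bounded by `exp M`, and is
controlled by a constant near the centre, then on smaller discs the logarithm of its absolute
value is `≤ C + η M` with arbitrarily small `η`. -/
lemma exists_abs_log_norm_le {r₁ r R B η : ℝ} (hr₁ : 0 < r₁) (hr : 0 ≤ r) (hr₁R : r₁ < R)
    (hrR : r < R) (hB : 0 ≤ B) (hη : 0 < η) :
    ∃ C : ℝ, ∀ (M : ℝ) (f : ℂ → ℂ) (c : ℂ), 0 ≤ M → DifferentiableOn ℂ f (Metric.ball c R) →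
      (∀ z ∈ Metric.ball c R, f z ≠ 0) → (∀ z ∈ Metric.ball c R, ‖f z‖ ≤ Real.exp M) →
      (∀ z ∈ Metric.ball c r₁, ‖f z‖ ≤ Real.exp B) → Real.exp (-B) ≤ ‖f c‖ →
      ∀ z, ‖z - c‖ ≤ r → |Real.log ‖f z‖| ≤ C + η * M := by
  set B₁ := B + Real.pi with hB₁
  have hB₁0 : 0 ≤ B₁ := by positivity
  have hR : 0 < R := hr.trans_lt hrR
  set ρ := (r + R) / 2 with hρ
  have hrρ : r < ρ := by rw [hρ]; linarith
  have hρR : ρ < R := by rw [hρ]; linarith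
  have hρ0 : 0 < ρ := hr.trans_lt hrρ
  set P := (2 * ρ + B₁ * (R + ρ)) / (R - ρ) with hP
  set Q := 2 * (B + 1) * (r₁ / 2) / (r₁ - r₁ / 2) + B₁ * (r₁ + r₁ / 2) / (r₁ - r₁ / 2) with hQ
  have hP0 : 0 ≤ P := by
    rw [hP]; exact div_nonneg (by positivity) (by linarith)
  have hx0 : 0 ≤ r / ρ := div_nonneg hr hρ0.le
  have hx1 : r / ρ < 1 := (div_lt_one hρ0).2 hrρ
  obtain ⟨N, hN⟩ : ∃ N : ℕ, P * (r / ρ) ^ N * (1 - r / ρ)⁻¹ < η := by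
    have h1 : Tendsto (fun N : ℕ => P * (r / ρ) ^ N * (1 - r / ρ)⁻¹) atTop (nhds 0) := by
      simpa using ((tendsto_pow_atTop_nhds_zero_of_lt_one hx0 hx1).const_mul P).mul_const
        (1 - r / ρ)⁻¹
    exact (h1.eventually (gt_mem_nhds hη)).exists
  refine ⟨(∑ n ∈ Finset.range N, Q * (r / (r₁ / 2)) ^ n) + η, ?_⟩
  intro M f c hM hf h0 hfM hfB hfc z hz
  obtain ⟨g, hg, hgc, hexp⟩ := exists_log_on_ball hR hf h0
  have hre : ∀ w ∈ Metric.ball c R, (g w).re = Real.log ‖f w‖ := by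
    intro w hw
    rw [← hexp w hw, norm_exp, Real.log_exp]
  have hle : ∀ w ∈ Metric.ball c R, ∀ S : ℝ, ‖f w‖ ≤ Real.exp S → (g w).re ≤ S := by
    intro w hw S hS
    rw [← hexp w hw, norm_exp] at hS
    exact Real.exp_le_exp.1 hS
  have hgc' : ‖g c‖ ≤ B₁ := by
    rw [hgc]
    refine (norm_le_abs_re_add_abs_im _).trans (add_le_add ?_ ?_)
    · rw [log_re, abs_le]
      have hpos : 0 < ‖f c‖ := (Real.exp_pos _).trans_le hfc
      exact ⟨(Real.le_log_iff_exp_le hpos).2 hfc,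
        (Real.log_le_iff_le_exp hpos).2 (hfB c (Metric.mem_ball_self hr₁))⟩
    · rw [log_im]; exact abs_arg_le_pi _
  have bc : ∀ (R' M' : ℝ), 0 < R' → R' ≤ R → 0 < M' →
      (∀ w ∈ Metric.ball c R', ‖f w‖ ≤ Real.exp M') → ∀ w, ‖w - c‖ < R' →
      ‖g w‖ ≤ 2 * M' * ‖w - c‖ / (R' - ‖w - c‖) + B₁ * (R' + ‖w - c‖) / (R' - ‖w - c‖) := by
    intro R' M' hR' hR'R hM' hb w hw
    have hsub : ∀ u ∈ Metric.ball (0 : ℂ) R', c + u ∈ Metric.ball c R' := by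
      intro u hu
      rw [mem_ball_iff_norm] at hu ⊢
      simpa using hu
    have hbig := Metric.ball_subset_ball (x := c) hR'R
    have h := borelCaratheodory (f := fun u => g (c + u)) (M := M') (R := R') (z := w - c) hM'
      (by
        refine (hg.mono hbig).comp ?_ hsub
        fun_prop)
      (fun u hu => hle _ (hbig (hsub u hu)) M' (hb _ (hsub u hu))) hR'
      (by rw [mem_ball_iff_norm]; simpa using hw)
    simp only [add_sub_cancel, add_zero] at h
    refine h.trans ?_
    have : 0 < R' - ‖w - c‖ := by linarith
    gcongr
  have hgz := norm_le_of_two_discs (z := z) (P := P * (M + 1)) (Q := Q) N (half_pos hr₁)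
    (by linarith) hr hrρ hρR hg (by
      intro w hw
      refine (bc R (M + 1) hR le_rfl (by linarith)
        (fun u hu => (hfM u hu).trans (Real.exp_le_exp.2 (by linarith))) w (by linarith)).trans ?_
      rw [hw, hP, ← add_div, div_mul_eq_mul_div]
      have : 0 < R - ρ := by linarith
      gcongr
      nlinarith [mul_nonneg hB₁0 (by linarith : 0 ≤ R + ρ)]) (by
      intro w hw
      have := bc r₁ (B + 1) hr₁ hr₁R.le (by linarith)
        (fun u hu => (hfB u hu).trans (Real.exp_le_exp.2 (by linarith))) w (by linarith)
      rwa [hw] at this) hz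
  have hzR : z ∈ Metric.ball c R := by rw [mem_ball_iff_norm]; linarith
  calc |Real.log ‖f z‖| = |(g z).re| := by rw [hre z hzR]
    _ ≤ ‖g z‖ := abs_re_le_norm _
    _ ≤ _ := hgz
    _ = (∑ n ∈ Finset.range N, Q * (r / (r₁ / 2)) ^ n) +
        (P * (r / ρ) ^ N * (1 - r / ρ)⁻¹) * (M + 1) := by ring
    _ ≤ (∑ n ∈ Finset.range N, Q * (r / (r₁ / 2)) ^ n) + η * (M + 1) := by
        gcongr
    _ = _ := by ring

open MeasureTheory Set in
theorem exists_norm_mellin_le {f : ℝ → ℂ} {a b : ℝ} (ha : MellinConvergent f (a : ℂ))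
    (hb : MellinConvergent f (b : ℂ)) :
    ∃ B, ∀ s : ℂ, a ≤ s.re → s.re ≤ b → ‖mellin f s‖ ≤ B := by
  refine ⟨(∫ t in Ioi (0 : ℝ), ‖(t : ℂ) ^ ((a : ℂ) - 1) • f t‖) +
    ∫ t in Ioi (0 : ℝ), ‖(t : ℂ) ^ ((b : ℂ) - 1) • f t‖, fun s hs₁ hs₂ => ?_⟩
  rw [← integral_add ha.norm hb.norm]
  refine norm_integral_le_of_norm_le (ha.norm.add hb.norm) ?_
  refine (ae_restrict_iff' measurableSet_Ioi).2 (Eventually.of_forall fun t (ht : 0 < t) => ?_)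
  simp only [norm_smul, norm_cpow_eq_rpow_re_of_pos ht, sub_re, ofReal_re, one_re]
  rw [← add_mul]
  gcongr
  rcases le_total 1 t with h | h
  · exact (Real.rpow_le_rpow_of_exponent_le h (by linarith : s.re - 1 ≤ b - 1)).trans
      (le_add_of_nonneg_left (by positivity))
  · exact (Real.rpow_le_rpow_of_exponent_ge ht h (by linarith : a - 1 ≤ s.re - 1)).trans
      (le_add_of_nonneg_right (by positivity))

theorem exists_norm_Gamma_le {a b : ℝ} (ha : 0 < a) (hab : a ≤ b) :
    ∃ B, 0 < B ∧ ∀ s : ℂ, a ≤ s.re → s.re ≤ b → ‖Gamma s‖ ≤ B := by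
  have key : ∀ c : ℝ, 0 < c → MellinConvergent (fun t : ℝ => ((Real.exp (-t) : ℝ) : ℂ)) (c : ℂ) := by
    intro c hc
    have := Complex.GammaIntegral_convergent (s := (c : ℂ)) (by simpa using hc)
    refine this.congr (Eventually.of_forall fun t => ?_)
    simp [smul_eq_mul, mul_comm]
  obtain ⟨B, hB⟩ := exists_norm_mellin_le (key a ha) (key b (ha.trans_le hab))
  refine ⟨max B 1, by positivity, fun s h₁ h₂ => ?_⟩
  rw [Complex.Gamma_eq_integral (ha.trans_le h₁), Complex.GammaIntegral_eq_mellin]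
  exact (hB s h₁ h₂).trans (le_max_left _ _)

theorem norm_sin_le_exp (z : ℂ) : ‖Complex.sin z‖ ≤ Real.exp |z.im| := by
  have h : ∀ w : ℂ, |w.re| ≤ |z.im| → ‖cexp w‖ ≤ Real.exp |z.im| := fun w hw => by
    rw [norm_exp]; exact Real.exp_le_exp.2 ((le_abs_self _).trans hw)
  rw [Complex.sin, norm_div, norm_mul, norm_I, mul_one, Complex.norm_two, div_le_iff₀ two_pos]
  refine (norm_sub_le _ _).trans ?_
  linarith [h (-z * I) (by simp), h (z * I) (by simp)]

theorem exists_norm_inv_Gamma_le :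
    ∃ C, 0 < C ∧ ∀ z : ℂ, -3 / 4 ≤ z.re → z.re ≤ 3 / 4 →
      ‖(Gamma z)⁻¹‖ ≤ C * Real.exp (Real.pi * |z.im|) := by
  obtain ⟨B, hB0, hB⟩ := exists_norm_Gamma_le (a := 1 / 4) (b := 7 / 4) (by norm_num) (by norm_num)
  refine ⟨B, hB0, fun z h₁ h₂ => ?_⟩
  have hG : Gamma (1 - z) ≠ 0 := Gamma_ne_zero_of_re_pos (by simp; linarith)
  have hb := hB (1 - z) (by simp; linarith) (by simp; linarith)
  have hsin := norm_sin_le_exp (Real.pi * z)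
  have him : ((Real.pi : ℂ) * z).im = Real.pi * z.im := by simp
  rw [him, abs_mul, abs_of_pos Real.pi_pos] at hsin
  by_cases h0 : Gamma z = 0
  · simp [h0]; positivity
  have hrefl := Complex.Gamma_mul_Gamma_one_sub z
  have hs : Complex.sin (Real.pi * z) ≠ 0 := by
    intro h
    rw [h, div_zero] at hrefl
    exact mul_ne_zero h0 hG hrefl
  have : (Gamma z)⁻¹ = Gamma (1 - z) * Complex.sin (Real.pi * z) / Real.pi := by
    have hpi : (Real.pi : ℂ) ≠ 0 := by exact_mod_cast Real.pi_ne_zero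
    rw [eq_div_iff hs] at hrefl
    rw [eq_div_iff hpi, inv_mul_eq_iff_eq_mul₀ h0]
    linear_combination -hrefl
  rw [this, norm_div, norm_mul, norm_real, Real.norm_of_nonneg Real.pi_pos.le]
  calc _ ≤ ‖Gamma (1 - z)‖ * ‖Complex.sin (Real.pi * z)‖ / 1 := by
        gcongr; linarith [Real.pi_gt_three]
    _ ≤ _ := by rw [div_one]; gcongr

theorem exists_norm_completedHurwitzZetaEven_le (a : UnitAddCircle) :
    ∃ B, ∀ s : ℂ, -1 / 2 ≤ s.re → s.re ≤ 3 / 2 → 1 ≤ |s.im| →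
      ‖HurwitzZeta.completedHurwitzZetaEven a s‖ ≤ B := by
  have hconv := fun s : ℂ =>
    ((HurwitzZeta.hurwitzEvenFEPair a).isStrongFEPair_toStrongFEPair.hasMellin s).1
  obtain ⟨B, hB⟩ := exists_norm_mellin_le (hconv ((-1 / 4 : ℝ) : ℂ)) (hconv ((3 / 4 : ℝ) : ℂ))
  refine ⟨B / 2 + 1 + 1, fun s h₁ h₂ h₃ => ?_⟩
  rw [HurwitzZeta.completedHurwitzZetaEven_eq]
  have e1 : ‖HurwitzZeta.completedHurwitzZetaEven₀ a s‖ ≤ B / 2 := by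
    rw [HurwitzZeta.completedHurwitzZetaEven₀, norm_div, Complex.norm_two]
    gcongr
    refine hB (s / 2) ?_ ?_ <;> simp <;> linarith
  have e2 : ‖(if a = 0 then (1 : ℂ) else 0) / s‖ ≤ 1 := by
    have : 1 ≤ ‖s‖ := h₃.trans (abs_im_le_norm s)
    rw [norm_div, div_le_one (by linarith)]
    split_ifs <;> simp; linarith
  have e3 : ‖1 / (1 - s)‖ ≤ 1 := by
    have : 1 ≤ ‖1 - s‖ := h₃.trans (by simpa using abs_im_le_norm (1 - s))
    rw [norm_div, norm_one, div_le_one (by linarith)]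
    exact this
  exact (norm_sub_le _ _).trans (add_le_add ((norm_sub_le _ _).trans (add_le_add e1 e2)) e3)

theorem exists_norm_completedHurwitzZetaOdd_le (a : UnitAddCircle) :
    ∃ B, ∀ s : ℂ, -1 / 2 ≤ s.re → s.re ≤ 3 / 2 →
      ‖HurwitzZeta.completedHurwitzZetaOdd a s‖ ≤ B := by
  have hP := HurwitzZeta.isStrong_hurwitzOddFEPair a
  have hconv := fun s : ℂ => (hP.hasMellin s).1
  obtain ⟨B, hB⟩ := exists_norm_mellin_le (hconv ((1 / 4 : ℝ) : ℂ)) (hconv ((5 / 4 : ℝ) : ℂ))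
  refine ⟨B / 2, fun s h₁ h₂ => ?_⟩
  rw [HurwitzZeta.completedHurwitzZetaOdd, norm_div, Complex.norm_two, hP.Λ_eq]
  gcongr
  refine hB ((s + 1) / 2) ?_ ?_ <;> simp <;> linarith

theorem exists_norm_inv_Gammaℝ_le :
    ∃ C, 0 < C ∧ ∀ z : ℂ, -3 / 2 ≤ z.re → z.re ≤ 3 / 2 →
      ‖(Gammaℝ z)⁻¹‖ ≤ C * Real.exp (Real.pi * |z.im|) := by
  obtain ⟨C, hC0, hC⟩ := exists_norm_inv_Gamma_le
  refine ⟨Real.pi * C, mul_pos Real.pi_pos hC0, fun z h₁ h₂ => ?_⟩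
  have := hC (z / 2) (by simp; linarith) (by simp; linarith)
  rw [Gammaℝ_def, mul_inv, norm_mul, ← cpow_neg, norm_cpow_eq_rpow_re_of_pos Real.pi_pos, mul_assoc]
  gcongr
  · calc _ ≤ Real.pi ^ (1 : ℝ) :=
          Real.rpow_le_rpow_of_exponent_le (by linarith [Real.pi_gt_three]) (by simp; linarith)
      _ = _ := Real.rpow_one _
  · refine this.trans ?_
    have : |(z / 2).im| ≤ |z.im| := by
      rw [div_ofNat_im, abs_div, Nat.abs_ofNat]
      linarith [abs_nonneg z.im]
    gcongr

theorem exists_norm_hurwitzZeta_le (a : UnitAddCircle) :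
    ∃ K, 0 ≤ K ∧ ∀ s : ℂ, -1 / 2 ≤ s.re → s.re ≤ 3 / 2 → 1 ≤ |s.im| →
      ‖HurwitzZeta.hurwitzZeta a s‖ ≤ K * Real.exp (4 * |s.im|) := by
  obtain ⟨B₁, hB₁⟩ := exists_norm_completedHurwitzZetaEven_le a
  obtain ⟨B₂, hB₂⟩ := exists_norm_completedHurwitzZetaOdd_le a
  obtain ⟨C, hC0, hC⟩ := exists_norm_inv_Gammaℝ_le
  refine ⟨|B₁| * C + |B₂| * (C * (4 * Real.pi)), by positivity, fun s h₁ h₂ h₃ => ?_⟩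
  have hs0 : s ≠ 0 := by rintro rfl; norm_num at h₃
  have hpi := Real.pi_lt_four
  have hexp : Real.exp (Real.pi * |s.im|) ≤ Real.exp (4 * |s.im|) := by gcongr
  have hG1 : ‖(Gammaℝ s)⁻¹‖ ≤ C * Real.exp (4 * |s.im|) :=
    (hC s (by linarith) h₂).trans (by gcongr)
  have hG2 : ‖(Gammaℝ (s + 1))⁻¹‖ ≤ C * (4 * Real.pi) * Real.exp (4 * |s.im|) := by
    have e : (s + 1) = (s - 1) + 2 := by ring
    have hs1 : s - 1 ≠ 0 := by
      intro h
      have := congrArg Complex.im h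
      simp at this
      rw [this] at h₃; norm_num at h₃
    rw [e, Gammaℝ_add_two hs1]
    have h := hC (s - 1) (by simp; linarith) (by simp; linarith)
    have him : (s - 1).im = s.im := by simp
    rw [him] at h
    have h1 : 1 ≤ ‖s - 1‖ := h₃.trans (by simpa using abs_im_le_norm (s - 1))
    have hb : ‖(s - 1)⁻¹‖ ≤ 1 := by
      rw [norm_inv]
      exact inv_le_one_of_one_le₀ h1
    have e2 : (Gammaℝ (s - 1) * (s - 1) / 2 / Real.pi)⁻¹ =
        (Gammaℝ (s - 1))⁻¹ * ((s - 1)⁻¹ * (2 * Real.pi)) := by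
      rw [inv_div, div_div_eq_mul_div, div_eq_mul_inv, mul_inv]
      ring
    rw [e2, norm_mul, norm_mul, norm_mul, Complex.norm_two, norm_real,
      Real.norm_of_nonneg Real.pi_pos.le]
    calc _ ≤ (C * Real.exp (Real.pi * |s.im|)) * (1 * (2 * Real.pi)) := by gcongr
      _ ≤ (C * Real.exp (4 * |s.im|)) * (1 * (4 * Real.pi)) := by
        gcongr
        norm_num
      _ = _ := by ring
  rw [HurwitzZeta.hurwitzZeta, HurwitzZeta.hurwitzZetaEven_def_of_ne_or_ne (Or.inr hs0),
    HurwitzZeta.hurwitzZetaOdd, div_eq_mul_inv, div_eq_mul_inv]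
  refine (norm_add_le _ _).trans ?_
  rw [norm_mul, norm_mul, add_mul, mul_assoc, mul_assoc]
  gcongr
  · exact (hB₁ s h₁ h₂ h₃).trans (le_abs_self _)
  · exact (hB₂ s h₁ h₂).trans (le_abs_self _)

/-- The entire function `(s - 1) L(s, Φ)`. -/
def regL {N : ℕ} [NeZero N] (Φ : ZMod N → ℂ) : ℂ → ℂ :=
  Function.update (fun s => (s - 1) * ZMod.LFunction Φ s) 1 (∑ j, Φ j / N)

theorem regL_of_ne_one {N : ℕ} [NeZero N] (Φ : ZMod N → ℂ) {s : ℂ} (hs : s ≠ 1) :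
    regL Φ s = (s - 1) * ZMod.LFunction Φ s := Function.update_of_ne hs _ _

theorem differentiable_regL {N : ℕ} [NeZero N] (Φ : ZMod N → ℂ) : Differentiable ℂ (regL Φ) := by
  have h0 : ∀ s, s ≠ 1 → DifferentiableAt ℂ (regL Φ) s := by
    intro s hs
    have h : DifferentiableAt ℂ (fun s => (s - 1) * ZMod.LFunction Φ s) s :=
      (differentiableAt_id.sub_const 1).mul (ZMod.differentiableAt_LFunction Φ s (Or.inl hs))
    refine h.congr_of_eventuallyEq ?_
    filter_upwards [isOpen_ne.mem_nhds hs] with z hz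
    exact regL_of_ne_one Φ hz
  intro s
  by_cases hs : s = 1
  · subst hs
    refine (Complex.analyticAt_of_differentiable_on_punctured_nhds_of_continuousAt ?_ ?_).differentiableAt
    · filter_upwards [self_mem_nhdsWithin] with z hz
      exact h0 z hz
    · rw [regL, continuousAt_update_same]
      exact ZMod.LFunction_residue_one Φ
  · exact h0 s hs

theorem exists_norm_regL_le_exp {N : ℕ} [NeZero N] (Φ : ZMod N → ℂ) :
    ∃ K, 0 ≤ K ∧ ∀ s : ℂ, -1 / 2 ≤ s.re → s.re ≤ 3 / 2 →
      ‖regL Φ s‖ ≤ K * Real.exp (K * |s.im|) := by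
  choose K hK0 hK using fun j : ZMod N => exists_norm_hurwitzZeta_le (ZMod.toAddCircle j)
  have hcomp : IsCompact (Set.Icc (-1 / 2 : ℝ) (3 / 2) ×ℂ Set.Icc (-1 : ℝ) 1) :=
    isCompact_Icc.reProdIm isCompact_Icc
  obtain ⟨M, hM⟩ := hcomp.exists_bound_of_continuousOn (differentiable_regL Φ).continuous.continuousOn
  have hS : 0 ≤ ∑ j, ‖Φ j‖ * K j := Finset.sum_nonneg fun j _ => mul_nonneg (norm_nonneg _) (hK0 j)
  have hN : 1 ≤ (N : ℝ) := by exact_mod_cast NeZero.one_le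
  set A := 3 * (N * ∑ j, ‖Φ j‖ * K j) with hA
  have hA0 : 0 ≤ A := by positivity
  refine ⟨max (|M|) A + 5, by positivity, fun s h₁ h₂ => ?_⟩
  rcases le_total |s.im| 1 with h | h
  · have := hM s ⟨⟨h₁, h₂⟩, abs_le.1 h⟩
    calc _ ≤ |M| * 1 := by rw [mul_one]; exact this.trans (le_abs_self _)
      _ ≤ _ := by
        gcongr
        · linarith [le_max_left |M| A]
        · exact Real.one_le_exp (by positivity)
  · have hs1 : s ≠ 1 := by rintro rfl; norm_num at h
    have hL : ‖ZMod.LFunction Φ s‖ ≤ N * ∑ j, ‖Φ j‖ * (K j * Real.exp (4 * |s.im|)) := by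
      rw [ZMod.LFunction, norm_mul, norm_natCast_cpow_of_pos (NeZero.pos N)]
      gcongr
      · calc _ ≤ (N : ℝ) ^ (1 : ℝ) :=
              Real.rpow_le_rpow_of_exponent_le hN (by rw [neg_re]; linarith)
          _ = _ := Real.rpow_one _
      · refine (norm_sum_le _ _).trans ?_
        gcongr with j
        rw [norm_mul]
        gcongr
        exact hK j s h₁ h₂ h
    have hs : ‖s - 1‖ ≤ 3 * Real.exp |s.im| := by
      have h3 := norm_le_abs_re_add_abs_im (s - 1)
      have h4 : |(s - 1).re| ≤ 2 := by rw [sub_re, one_re, abs_le]; constructor <;> linarith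
      have h5 : (s - 1).im = s.im := by simp
      rw [h5] at h3
      have := Real.add_one_le_exp |s.im|
      linarith [Real.exp_pos |s.im|]
    rw [regL_of_ne_one Φ hs1, norm_mul]
    calc _ ≤ (3 * Real.exp |s.im|) * (N * ∑ j, ‖Φ j‖ * (K j * Real.exp (4 * |s.im|))) := by gcongr
      _ = A * (Real.exp (|s.im|) * Real.exp (4 * |s.im|)) := by
        simp_rw [hA, ← mul_assoc, ← Finset.sum_mul]; ring
      _ = A * Real.exp (5 * |s.im|) := by rw [← Real.exp_add]; ring_nf
      _ ≤ _ := by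
        gcongr
        · linarith [le_max_right |M| A]
        · linarith [le_max_right |M| A]

theorem exists_norm_LFunction_le_of_re_ge {N : ℕ} [NeZero N] (Φ : ZMod N → ℂ) :
    ∃ B, 0 ≤ B ∧ ∀ s : ℂ, 5 / 4 ≤ s.re → ‖ZMod.LFunction Φ s‖ ≤ B := by
  have hsum : LSeriesSummable (fun n : ℕ => Φ n) ((5 / 4 : ℝ) : ℂ) :=
    ZMod.LSeriesSummable_of_one_lt_re Φ (by rw [ofReal_re]; norm_num)
  refine ⟨∑' n, ‖LSeries.term (fun n : ℕ => Φ n) ((5 / 4 : ℝ) : ℂ) n‖,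
    tsum_nonneg fun _ => norm_nonneg _, fun s hs => ?_⟩
  rw [ZMod.LFunction_eq_LSeries Φ (by linarith)]
  refine tsum_of_norm_bounded hsum.norm.hasSum fun n => ?_
  exact LSeries.norm_term_le_of_re_le_re _ (by simpa using hs) n

theorem norm_Gamma_half_add_le (u : ℝ) :
    ‖Gamma (1 / 2 + u * I)‖ ≤ 3 * Real.exp (-(Real.pi * |u| / 2)) := by
  have h1 : (1 : ℂ) - (1 / 2 + u * I) = (starRingEnd ℂ) (1 / 2 + u * I) := by
    apply Complex.ext <;> simp; norm_num
  have h2 := Complex.Gamma_mul_Gamma_one_sub (1 / 2 + u * I)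
  have h3 : Complex.sin (Real.pi * (1 / 2 + u * I)) = ((Real.cosh (Real.pi * u) : ℝ) : ℂ) := by
    rw [show (Real.pi : ℂ) * (1 / 2 + u * I) = (Real.pi * u : ℝ) * I + Real.pi / 2 by push_cast; ring,
      Complex.sin_add_pi_div_two, Complex.cos_mul_I, Complex.ofReal_cosh]
  rw [h1, Complex.Gamma_conj, Complex.mul_conj, h3, ← ofReal_div, Complex.ofReal_inj,
    normSq_eq_norm_sq] at h2
  have h4 : Real.exp (Real.pi * |u|) / 2 ≤ Real.cosh (Real.pi * u) := by
    rw [← Real.cosh_abs, abs_mul, abs_of_pos Real.pi_pos, Real.cosh_eq]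
    have := Real.exp_pos (-(Real.pi * |u|))
    linarith
  refine abs_le_of_sq_le_sq' ?_ (by positivity) |>.2
  rw [h2, mul_pow, ← Real.exp_nat_mul]
  have h5 : Real.exp ((2 : ℕ) * -(Real.pi * |u| / 2)) = (Real.exp (Real.pi * |u|))⁻¹ := by
    rw [← Real.exp_neg]; congr 1; push_cast; ring
  rw [h5, div_le_iff₀ (Real.cosh_pos _)]
  have hE := Real.exp_pos (Real.pi * |u|)
  calc Real.pi ≤ 3 ^ 2 / 2 := by linarith [Real.pi_lt_four]
    _ = 3 ^ 2 * (Real.exp (Real.pi * |u|))⁻¹ * (Real.exp (Real.pi * |u|) / 2) := by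
      field_simp
    _ ≤ _ := by gcongr

theorem norm_Gamma_three_half_add_le (u : ℝ) :
    ‖Gamma (3 / 2 + u * I)‖ ≤ 3 * (1 + |u|) * Real.exp (-(Real.pi * |u| / 2)) := by
  have h : (1 / 2 + u * I : ℂ) ≠ 0 := by
    intro h
    have := congrArg Complex.re h
    norm_num at this
  rw [show (3 / 2 + u * I : ℂ) = 1 / 2 + u * I + 1 by ring, Gamma_add_one _ h, norm_mul]
  have h1 : ‖(1 / 2 + u * I : ℂ)‖ ≤ 1 + |u| := by
    refine (norm_add_le _ _).trans ?_
    simp only [norm_mul, norm_I, mul_one, norm_real, Real.norm_eq_abs]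
    norm_num
  calc _ ≤ (1 + |u|) * (3 * Real.exp (-(Real.pi * |u| / 2))) := by
        gcongr; exact norm_Gamma_half_add_le u
    _ = _ := by ring

open ZMod in
theorem exists_norm_LFunction_left_le {N : ℕ} [NeZero N] (Φ : ZMod N → ℂ) :
    ∃ A, 0 ≤ A ∧ ∀ s : ℂ, s.re = -1 / 2 → ‖ZMod.LFunction Φ s‖ ≤ A * (1 + |s.im|) := by
  obtain ⟨B₁, hB₁0, hB₁⟩ := exists_norm_LFunction_le_of_re_ge (𝓕 Φ)
  obtain ⟨B₂, hB₂0, hB₂⟩ := exists_norm_LFunction_le_of_re_ge (𝓕 fun x => Φ (-x))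
  have hN : 1 ≤ (N : ℝ) := by exact_mod_cast NeZero.one_le
  refine ⟨N * (3 * (B₁ + B₂)), by positivity, fun s hs => ?_⟩
  set w : ℂ := 1 - s with hw
  have hwre : w.re = 3 / 2 := by rw [hw, sub_re, hs, one_re]; norm_num
  have hwim : w.im = -s.im := by simp [hw]
  have hweq : w = 3 / 2 + (w.im : ℝ) * I := by
    apply Complex.ext <;> simp [hwre]
  have hfe := ZMod.LFunction_one_sub Φ (s := w) (fun n h => by
      have := congrArg Complex.re h
      simp only [neg_re, natCast_re, hwre] at this
      have h0 : (0 : ℝ) ≤ n := n.cast_nonneg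
      linarith) (Or.inr fun h => by rw [h] at hwre; norm_num at hwre)
  rw [show 1 - w = s by simp [hw]] at hfe
  have hG := norm_Gamma_three_half_add_le w.im
  rw [← hweq, hwim, abs_neg] at hG
  have hexp : ∀ z : ℂ, |z.re| ≤ Real.pi * |s.im| / 2 → ‖cexp z‖ ≤ Real.exp (Real.pi * |s.im| / 2) :=
    fun z hz => by rw [norm_exp]; exact Real.exp_le_exp.2 ((le_abs_self _).trans hz)
  have e1 : ‖cexp (Real.pi * I * w / 2)‖ ≤ Real.exp (Real.pi * |s.im| / 2) := by
    apply hexp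
    have : ((Real.pi : ℂ) * I * w / 2).re = Real.pi * s.im / 2 := by simp [hwim]
    rw [this, abs_div, abs_mul, abs_of_pos Real.pi_pos, abs_two]
  have e2 : ‖cexp (-Real.pi * I * w / 2)‖ ≤ Real.exp (Real.pi * |s.im| / 2) := by
    apply hexp
    have : (-(Real.pi : ℂ) * I * w / 2).re = -(Real.pi * s.im / 2) := by simp [hwim]; ring
    rw [this, abs_neg, abs_div, abs_mul, abs_of_pos Real.pi_pos, abs_two]
  have e3 : ‖(N : ℂ) ^ (w - 1)‖ ≤ N := by
    rw [norm_natCast_cpow_of_pos (NeZero.pos N)]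
    calc _ ≤ (N : ℝ) ^ (1 : ℝ) :=
          Real.rpow_le_rpow_of_exponent_le hN (by rw [sub_re, hwre, one_re]; norm_num)
      _ = _ := Real.rpow_one _
  have e4 : ‖(2 * Real.pi : ℂ) ^ (-w)‖ ≤ 1 := by
    have h2p : (0 : ℝ) < 2 * Real.pi := by positivity
    have := norm_cpow_eq_rpow_re_of_pos h2p (-w)
    push_cast at this
    rw [this]
    exact Real.rpow_le_one_of_one_le_of_nonpos (by linarith [Real.pi_gt_three])
      (by rw [neg_re, hwre]; norm_num)
  rw [hfe, norm_mul, norm_mul, norm_mul]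
  set E := Real.exp (Real.pi * |s.im| / 2) with hE
  have hE0 : 0 < E := Real.exp_pos _
  rw [Real.exp_neg, ← hE] at hG
  calc _ ≤ N * 1 * (3 * (1 + |s.im|) * E⁻¹) * (E * B₁ + E * B₂) := by
        gcongr
        refine (norm_add_le _ _).trans ?_
        rw [norm_mul, norm_mul]
        gcongr
        · exact hB₁ w (by rw [hwre]; norm_num)
        · exact hB₂ w (by rw [hwre]; norm_num)
    _ = _ := by field_simp

theorem exists_norm_regL_left_le {N : ℕ} [NeZero N] (Φ : ZMod N → ℂ) :
    ∃ A, 0 ≤ A ∧ ∀ s : ℂ, s.re = -1 / 2 → ‖regL Φ s‖ ≤ A * (1 + |s.im|) ^ (2 : ℝ) := by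
  obtain ⟨A, hA0, hA⟩ := exists_norm_LFunction_left_le Φ
  refine ⟨2 * A, by positivity, fun s hs => ?_⟩
  rw [regL_of_ne_one Φ (by rintro rfl; norm_num at hs), norm_mul]
  have h3 := norm_le_abs_re_add_abs_im (s - 1)
  have h4 : |(s - 1).re| = 3 / 2 := by rw [sub_re, hs, one_re]; norm_num [abs_of_neg]
  have h5 : (s - 1).im = s.im := by simp
  rw [h4, h5] at h3
  calc _ ≤ (2 * (1 + |s.im|)) * (A * (1 + |s.im|)) := by
        gcongr
        · linarith [abs_nonneg s.im]
        · exact hA s hs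
    _ = _ := by rw [Real.rpow_two]; ring

theorem exists_norm_regL_right_le {N : ℕ} [NeZero N] (Φ : ZMod N → ℂ) :
    ∃ A, 0 ≤ A ∧ ∀ s : ℂ, s.re = 3 / 2 → ‖regL Φ s‖ ≤ A * (1 + |s.im|) ^ (1 : ℝ) := by
  obtain ⟨A, hA0, hA⟩ := exists_norm_LFunction_le_of_re_ge Φ
  refine ⟨A, by positivity, fun s hs => ?_⟩
  rw [regL_of_ne_one Φ (by rintro rfl; norm_num at hs), norm_mul, Real.rpow_one, mul_comm]
  have h3 := norm_le_abs_re_add_abs_im (s - 1)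
  have h4 : |(s - 1).re| = 1 / 2 := by rw [sub_re, hs, one_re]; norm_num [abs_of_pos]
  have h5 : (s - 1).im = s.im := by simp
  rw [h4, h5] at h3
  gcongr
  · exact hA s (by rw [hs]; norm_num)
  · linarith

/-- Polynomial growth of `(s - 1) L(s, Φ)` in vertical strips. -/
theorem exists_norm_regL_le_sq {N : ℕ} [NeZero N] (Φ : ZMod N → ℂ) :
    ∃ C, 0 < C ∧ ∀ s : ℂ, -1 / 2 ≤ s.re → s.re ≤ 3 / 2 →
      ‖regL Φ s‖ ≤ C * (1 + |s.im|) ^ (2 : ℝ) := by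
  obtain ⟨K, hK0, hK⟩ := exists_norm_regL_le_exp Φ
  obtain ⟨A, hA0, hA⟩ := exists_norm_regL_left_le Φ
  obtain ⟨B, hB0, hB⟩ := exists_norm_regL_right_le Φ
  have hB' : ∀ s : ℂ, s.re = 3 / 2 → ‖regL Φ s‖ ≤ B * (1 + |s.im|) ^ (2 : ℝ) := fun s hs =>
    (hB s hs).trans <| mul_le_mul_of_nonneg_left (Real.rpow_le_rpow_of_exponent_le
      (le_add_of_nonneg_right (abs_nonneg _)) one_le_two) hB0
  obtain ⟨C, hC0, hC⟩ := exists_norm_le_of_verticalStrip (by norm_num) (differentiable_regL Φ)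
    (by norm_num) (by norm_num) hK0 hK hA hB'
  refine ⟨C, hC0, fun s h₁ h₂ => (hC s h₁ h₂).trans_eq ?_⟩
  congr 2
  ring

theorem LFunction_ne_zero_of_GRH {N : ℕ} [NeZero N] {ψ : DirichletCharacter ℂ N} (h : GRH ψ)
    {s : ℂ} (hs : 1 / 2 < s.re) (hs1 : s ≠ 1) : ZMod.LFunction ψ s ≠ 0 := by
  rcases lt_or_ge s.re 1 with h1 | h1
  · intro h0
    have := h s (by linarith) h1 (by rw [LVal, dif_neg (NeZero.ne N)]; exact h0)
    linarith
  · exact DirichletCharacter.LFunction_ne_zero_of_one_le_re ψ (Or.inr hs1) h1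

theorem exists_norm_LFunction_two_add_ge {N : ℕ} [NeZero N] (ψ : DirichletCharacter ℂ N) :
    ∃ m, 0 < m ∧ ∀ t : ℝ, m⁻¹ ≤ ‖ZMod.LFunction ψ (2 + t * I)‖ := by
  set g : ℕ → ℂ := (fun n : ℕ => ψ n) * fun n => (ArithmeticFunction.moebius n : ℂ) with hg
  have hsum : LSeriesSummable g ((3 / 2 : ℝ) : ℂ) := by
    refine LSeriesSummable_of_bounded_of_one_lt_re (m := 1) (fun n _ => ?_)
      (by rw [ofReal_re]; norm_num)
    rw [hg, Pi.mul_apply, norm_mul]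
    refine mul_le_one₀ (ψ.norm_le_one _) (norm_nonneg _) ?_
    rw [norm_intCast]
    exact_mod_cast ArithmeticFunction.abs_moebius_le_one
  set S := ∑' n, ‖LSeries.term g ((3 / 2 : ℝ) : ℂ) n‖ with hS
  have hS0 : 0 ≤ S := tsum_nonneg fun _ => norm_nonneg _
  refine ⟨S + 1, by positivity, fun t => ?_⟩
  have hre : (2 + t * I : ℂ).re = 2 := by simp
  have h1 := DirichletCharacter.LSeries.mul_mu_eq_one ψ (s := 2 + t * I) (by rw [hre]; norm_num)
  rw [← ZMod.LFunction_eq_LSeries (ψ ·) (by rw [hre]; norm_num)] at h1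
  have h2 : ‖LSeries g (2 + t * I)‖ ≤ S := by
    refine tsum_of_norm_bounded hsum.norm.hasSum fun n => ?_
    exact LSeries.norm_term_le_of_re_le_re _ (by rw [hre, ofReal_re]; norm_num) n
  have h3 : ‖ZMod.LFunction ψ (2 + t * I)‖ * ‖LSeries g (2 + t * I)‖ = 1 := by
    rw [← norm_mul, h1, norm_one]
  rw [inv_le_iff_one_le_mul₀ (by positivity), ← h3]
  gcongr
  linarith

/-- Under GRH, `log |L(s, ψ)|` is `o(log |t|)` to the right of the critical line. -/
theorem GRH.exists_abs_log_norm_LFunction_le {N : ℕ} [NeZero N] {ψ : DirichletCharacter ℂ N}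
    (h : GRH ψ) {δ η : ℝ} (hδ : 0 < δ) (hδ' : δ < 1 / 2) (hη : 0 < η) :
    ∃ C, ∀ s : ℂ, 1 / 2 + δ ≤ s.re → s.re ≤ 2 → 2 ≤ |s.im| →
      |Real.log ‖ZMod.LFunction ψ s‖| ≤ C + η * Real.log (1 + |s.im|) := by
  obtain ⟨C₁, hC₁0, hC₁⟩ := exists_norm_regL_le_sq (ψ : ZMod N → ℂ)
  obtain ⟨B, hB0, hB⟩ := exists_norm_LFunction_le_of_re_ge (ψ : ZMod N → ℂ)
  obtain ⟨m, hm0, hm⟩ := exists_norm_LFunction_two_add_ge ψ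
  obtain ⟨C, hC⟩ := exists_abs_log_norm_le (r₁ := 3 / 4) (r := 3 / 2 - δ) (R := 3 / 2)
    (B := max B m) (η := η / 2) (by norm_num) (by linarith) (by norm_num) (by linarith)
    (le_max_of_le_left hB0) (by linarith)
  set A := 18 * C₁ + B + 1 with hA
  have hA1 : 1 ≤ A := by linarith
  refine ⟨C + η / 2 * Real.log A, fun s h₁ h₂ h₃ => ?_⟩
  set c : ℂ := 2 + s.im * I with hc
  have hcre : c.re = 2 := by simp [hc]
  have hcim : c.im = s.im := by simp [hc]
  set T := 1 + |s.im| with hT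
  have hT1 : 1 ≤ T := by linarith
  have hT0 : 0 < T := by linarith
  have hlogT := Real.log_nonneg hT1
  have hball : ∀ z ∈ Metric.ball c (3 / 2), 1 / 2 < z.re ∧ 1 / 2 ≤ |z.im| ∧ |z.im| ≤ |s.im| + 3 / 2 := by
    intro z hz
    rw [Metric.mem_ball, dist_eq_norm] at hz
    have h4 := (abs_re_le_norm (z - c)).trans_lt hz
    have h5 := (abs_im_le_norm (z - c)).trans_lt hz
    rw [sub_re, hcre, abs_lt] at h4
    rw [sub_im, hcim] at h5
    have h6 := abs_sub_abs_le_abs_sub s.im z.im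
    have h7 := abs_sub_abs_le_abs_sub z.im s.im
    rw [abs_sub_comm] at h6
    exact ⟨by linarith, by linarith, by linarith⟩
  have hne1 : ∀ z ∈ Metric.ball c (3 / 2), z ≠ 1 := by
    rintro z hz rfl
    have := (hball 1 hz).2.1
    norm_num at this
  have main := hC (Real.log A + 2 * Real.log T) (fun z => ZMod.LFunction ψ z) c
    (by have := Real.log_nonneg hA1; positivity)
    (fun z hz => (ZMod.differentiableAt_LFunction ψ z (Or.inl (hne1 z hz))).differentiableWithinAt)
    (fun z hz => LFunction_ne_zero_of_GRH h (hball z hz).1 (hne1 z hz))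
    (fun z hz => ?_) (fun z hz => ?_) ?_ s ?_
  · refine main.trans (le_of_eq ?_)
    ring
  · obtain ⟨hz1, hz2, hz3⟩ := hball z hz
    rw [Real.exp_add, Real.exp_log (by linarith), two_mul, Real.exp_add, Real.exp_log hT0]
    have hTT : 1 ≤ T * T := by nlinarith
    rcases le_total z.re (3 / 2) with h4 | h4
    · have h5 := hC₁ z (by linarith) h4
      rw [regL_of_ne_one _ (hne1 z hz), norm_mul, Real.rpow_two] at h5
      have h6 : 1 / 2 ≤ ‖z - 1‖ := hz2.trans (by simpa using abs_im_le_norm (z - 1))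
      have h7 : 1 / 2 * ‖ZMod.LFunction ψ z‖ ≤ C₁ * (3 * T) ^ 2 :=
        calc _ ≤ ‖z - 1‖ * ‖ZMod.LFunction ψ z‖ := by gcongr
          _ ≤ C₁ * (1 + |z.im|) ^ 2 := h5
          _ ≤ _ := by gcongr; linarith
      calc _ ≤ 18 * C₁ * (T * T) := by linarith
        _ ≤ _ := by gcongr; linarith
    · calc _ ≤ B * 1 := by rw [mul_one]; exact hB z (by linarith)
        _ ≤ _ := by gcongr; linarith
  · rw [Metric.mem_ball, dist_eq_norm] at hz
    have h4 := (abs_re_le_norm (z - c)).trans_lt hz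
    rw [sub_re, hcre, abs_lt] at h4
    refine (hB z (by linarith)).trans ((le_max_left B m).trans ?_)
    linarith [Real.add_one_le_exp (max B m)]
  · refine le_trans ?_ (hm s.im)
    rw [Real.exp_neg]
    gcongr
    linarith [Real.add_one_le_exp (max B m), le_max_right B m]
  · have : s - c = ((s.re - 2 : ℝ) : ℂ) := by
      apply Complex.ext <;> simp [hcre, hcim]
    rw [this, norm_real, Real.norm_eq_abs, abs_le]
    constructor <;> linarith

theorem GRH.exists_norm_regL_le_of_re_eq {N : ℕ} [NeZero N] {ψ : DirichletCharacter ℂ N}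
    (h : GRH ψ) {δ η : ℝ} (hδ : 0 < δ) (hδ' : δ < 1 / 2) (hη : 0 < η) :
    ∃ C, ∀ s : ℂ, s.re = 1 / 2 + δ → ‖regL ψ s‖ ≤ C * (1 + |s.im|) ^ (1 + η) := by
  obtain ⟨C, hC⟩ := h.exists_abs_log_norm_LFunction_le hδ hδ' hη
  have hcomp : IsCompact (Set.Icc (-1 / 2 : ℝ) (3 / 2) ×ℂ Set.Icc (-2 : ℝ) 2) :=
    isCompact_Icc.reProdIm isCompact_Icc
  obtain ⟨M, hM⟩ := hcomp.exists_bound_of_continuousOn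
    (differentiable_regL (ψ : ZMod N → ℂ)).continuous.continuousOn
  refine ⟨max |M| (Real.exp C), fun s hs => ?_⟩
  have hT1 : 1 ≤ 1 + |s.im| := le_add_of_nonneg_right (abs_nonneg _)
  rcases le_total |s.im| 2 with h1 | h1
  · calc _ ≤ |M| * 1 := by
          rw [mul_one]
          exact (hM s ⟨⟨by linarith, by linarith⟩, abs_le.1 h1⟩).trans (le_abs_self _)
      _ ≤ _ := by
        gcongr
        · exact le_max_left _ _
        · exact Real.one_le_rpow hT1 (by linarith)
  · have hs1 : s ≠ 1 := by rintro rfl; norm_num at h1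
    have h2 := (le_abs_self _).trans (hC s hs.ge (by linarith) h1)
    have h3 : ‖ZMod.LFunction ψ s‖ ≤ Real.exp C * (1 + |s.im|) ^ η := by
      rw [Real.rpow_def_of_pos (by linarith), ← Real.exp_add, mul_comm (Real.log _)]
      exact (Real.log_le_iff_le_exp
        (norm_pos_iff.2 (LFunction_ne_zero_of_GRH h (by linarith) hs1))).1 h2
    have h4 : ‖s - 1‖ ≤ 1 + |s.im| := by
      have h3 := norm_le_abs_re_add_abs_im (s - 1)
      have h4 : |(s - 1).re| ≤ 1 := by rw [sub_re, one_re, abs_le]; constructor <;> linarith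
      have h5 : (s - 1).im = s.im := by simp
      rw [h5] at h3
      linarith
    rw [regL_of_ne_one _ hs1, norm_mul, Real.rpow_add (by linarith), Real.rpow_one]
    calc _ ≤ (1 + |s.im|) * (Real.exp C * (1 + |s.im|) ^ η) := by gcongr
      _ = Real.exp C * ((1 + |s.im|) * (1 + |s.im|) ^ η) := by ring
      _ ≤ _ := by gcongr; exact le_max_right _ _

/-- The Lindelöf bound for `(s - 1) L(s, ψ)` in a strip around the critical line. -/
theorem GRH.exists_norm_regL_le {N : ℕ} [NeZero N] {ψ : DirichletCharacter ℂ N}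
    (h : GRH ψ) {c η : ℝ} (hc : 0 < c) (hc1 : c < 1) (hη : 0 < η) :
    ∃ C, 0 < C ∧ ∀ s : ℂ, 1 / 2 - c ≤ s.re → s.re ≤ 3 / 2 →
      ‖regL ψ s‖ ≤ C * (1 + |s.im|) ^ (1 + c + η) := by
  set δ := min η 1 / 3 with hδ
  have hδ0 : 0 < δ := by positivity
  have hδ1 : δ ≤ 1 / 3 := by have := min_le_right η 1; linarith
  have hδη : 3 * δ ≤ η := by have := min_le_left η 1; linarith
  obtain ⟨K, hK0, hK⟩ := exists_norm_regL_le_exp (ψ : ZMod N → ℂ)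
  obtain ⟨A, hA0, hA⟩ := exists_norm_regL_left_le (ψ : ZMod N → ℂ)
  obtain ⟨A', hA'0, hA'⟩ := exists_norm_regL_right_le (ψ : ZMod N → ℂ)
  obtain ⟨B, hB⟩ := h.exists_norm_regL_le_of_re_eq hδ0 (by linarith) hδ0
  obtain ⟨C₁, hC₁0, hC₁⟩ := exists_norm_le_of_verticalStrip (by linarith : -1 / 2 < 1 / 2 + δ)
    (differentiable_regL (ψ : ZMod N → ℂ)) (by norm_num) (by linarith) hK0
    (fun s h₁ h₂ => hK s h₁ (by linarith)) hA hB
  obtain ⟨C₂, hC₂0, hC₂⟩ := exists_norm_le_of_verticalStrip (by linarith : 1 / 2 + δ < 3 / 2)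
    (differentiable_regL (ψ : ZMod N → ℂ)) (by linarith) (by norm_num) hK0
    (fun s h₁ h₂ => hK s (by linarith) h₂) hB hA'
  refine ⟨max C₁ C₂, by positivity, fun s h₁ h₂ => ?_⟩
  have hT1 : 1 ≤ 1 + |s.im| := le_add_of_nonneg_right (abs_nonneg _)
  rcases le_total s.re (1 / 2 + δ) with h3 | h3
  · refine (hC₁ s (by linarith) h3).trans ?_
    refine mul_le_mul (le_max_left _ _) (Real.rpow_le_rpow_of_exponent_le hT1 ?_)
      (by positivity) (by positivity)
    have e : (1 / 2 + δ - -1 / 2) = 1 + δ := by ring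
    rw [e]
    have h4 : (1 - c) / (1 + δ) ≤ (s.re - -1 / 2) / (1 + δ) :=
      div_le_div_of_nonneg_right (by linarith) (by positivity)
    have h5 : (1 - c) * (1 - δ) ≤ (1 - c) / (1 + δ) := by
      rw [le_div_iff₀ (by positivity)]
      nlinarith [mul_nonneg (sub_nonneg.2 hc1.le) (sq_nonneg δ)]
    have h6 : (s.re - -1 / 2) / (1 + δ) ≤ 1 := by
      rw [div_le_one (by positivity)]; linarith
    generalize (s.re - -1 / 2) / (1 + δ) = τ at *
    have h7 := mul_le_mul_of_nonneg_right (h5.trans h4) (by linarith : 0 ≤ 1 - δ)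
    nlinarith [mul_pos hc hδ0, mul_nonneg (sub_nonneg.2 hc1.le) (sq_nonneg δ)]
  · refine (hC₂ s h3 h₂).trans ?_
    refine mul_le_mul (le_max_right _ _) (Real.rpow_le_rpow_of_exponent_le hT1 ?_)
      (by positivity) (by positivity)
    have h4 : (s.re - (1 / 2 + δ)) / (3 / 2 - (1 / 2 + δ)) ≤ 1 := by
      rw [div_le_one (by linarith)]; linarith
    have h5 : 0 ≤ (s.re - (1 / 2 + δ)) / (3 / 2 - (1 / 2 + δ)) :=
      div_nonneg (by linarith) (by linarith)
    generalize (s.re - (1 / 2 + δ)) / (3 / 2 - (1 / 2 + δ)) = τ at *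
    nlinarith [mul_nonneg h5 hδ0.le]

theorem GRH.exists_norm_LFunction_le {N : ℕ} [NeZero N] {ψ : DirichletCharacter ℂ N}
    (h : GRH ψ) {c η t₀ : ℝ} (hc : 0 < c) (hc1 : c < 1) (hη : 0 < η) (ht₀ : 0 < t₀) :
    ∃ C, 0 < C ∧ ∀ s : ℂ, 1 / 2 - c ≤ s.re → s.re ≤ 3 / 2 → t₀ ≤ |s.im| →
      ‖ZMod.LFunction ψ s‖ ≤ C * (1 + |s.im|) ^ (c + η) := by
  obtain ⟨C, hC0, hC⟩ := h.exists_norm_regL_le hc hc1 hη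
  refine ⟨(1 + t₀) / t₀ * C, by positivity, fun s h₁ h₂ h₃ => ?_⟩
  have hs1 : s ≠ 1 := by rintro rfl; simp at h₃; linarith
  have h4 := hC s h₁ h₂
  have h5 : |s.im| ≤ ‖s - 1‖ := by simpa using abs_im_le_norm (s - 1)
  have hT0 : 0 < 1 + |s.im| := by positivity
  rw [regL_of_ne_one _ hs1, norm_mul, add_assoc, Real.rpow_add hT0, Real.rpow_one] at h4
  have h6 : t₀ / (1 + t₀) * (1 + |s.im|) ≤ ‖s - 1‖ := by
    refine le_trans ?_ h5
    rw [div_mul_eq_mul_div, div_le_iff₀ (by positivity)]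
    linarith
  have h7 : (t₀ / (1 + t₀) * (1 + |s.im|)) * ‖ZMod.LFunction ψ s‖ ≤
      C * ((1 + |s.im|) * (1 + |s.im|) ^ (c + η)) := le_trans (by gcongr) h4
  have h8 : (1 + |s.im|) * (t₀ / (1 + t₀) * ‖ZMod.LFunction ψ s‖) ≤
      (1 + |s.im|) * (C * (1 + |s.im|) ^ (c + η)) := by linarith
  have h9 := le_of_mul_le_mul_left h8 hT0
  rw [div_mul_eq_mul_div, div_mul_eq_mul_div, le_div_iff₀ ht₀]
  rw [div_mul_eq_mul_div, div_le_iff₀ (by positivity)] at h9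
  linarith

theorem GRH.exists_norm_LFunction_ge {N : ℕ} [NeZero N] {ψ : DirichletCharacter ℂ N}
    (h : GRH ψ) {η t₀ : ℝ} (hη : 0 < η) (ht₀ : 0 < t₀) :
    ∃ C, 0 < C ∧ ∀ s : ℂ, 3 / 4 ≤ s.re → s.re ≤ 2 → t₀ ≤ |s.im| →
      ‖ZMod.LFunction ψ s‖⁻¹ ≤ C * (1 + |s.im|) ^ η := by
  obtain ⟨C, hC⟩ := h.exists_abs_log_norm_LFunction_le (δ := 1 / 4) (by norm_num) (by norm_num) hη
  have hcomp : IsCompact ((Set.Icc (3 / 4 : ℝ) 2 ×ℂ Set.Icc (-2 : ℝ) 2) ∩ {s : ℂ | t₀ ≤ |s.im|}) :=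
    (isCompact_Icc.reProdIm isCompact_Icc).inter_right
      (isClosed_le continuous_const (continuous_abs.comp continuous_im))
  have hne1 : ∀ s : ℂ, t₀ ≤ |s.im| → s ≠ 1 := by
    rintro s hs rfl
    simp at hs
    linarith
  have hcont : ContinuousOn (fun s => (ZMod.LFunction ψ s)⁻¹)
      ((Set.Icc (3 / 4 : ℝ) 2 ×ℂ Set.Icc (-2 : ℝ) 2) ∩ {s : ℂ | t₀ ≤ |s.im|}) := by
    intro s hs
    refine ContinuousAt.continuousWithinAt (ContinuousAt.inv₀ ?_ ?_)
    · exact (ZMod.differentiableAt_LFunction ψ s (Or.inl (hne1 s hs.2))).continuousAt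
    · exact LFunction_ne_zero_of_GRH h (by linarith [hs.1.1.1]) (hne1 s hs.2)
  obtain ⟨M, hM⟩ := hcomp.exists_bound_of_continuousOn hcont
  refine ⟨max |M| (Real.exp C), by positivity, fun s h₁ h₂ h₃ => ?_⟩
  have hT1 : 1 ≤ 1 + |s.im| := le_add_of_nonneg_right (abs_nonneg _)
  rcases le_total |s.im| 2 with h4 | h4
  · have := hM s ⟨⟨⟨h₁, h₂⟩, abs_le.1 h4⟩, h₃⟩
    rw [norm_inv] at this
    calc _ ≤ |M| * 1 := by rw [mul_one]; exact this.trans (le_abs_self _)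
      _ ≤ _ := by
        gcongr
        · exact le_max_left _ _
        · exact Real.one_le_rpow hT1 hη.le
  · have hL : 0 < ‖ZMod.LFunction ψ s‖ :=
      norm_pos_iff.2 (LFunction_ne_zero_of_GRH h (by linarith) (hne1 s h₃))
    have h2 := (neg_le_abs _).trans (hC s (by linarith) h₂ h4)
    rw [← Real.log_inv, Real.log_le_iff_le_exp (inv_pos.2 hL), Real.exp_add, mul_comm η,
      ← Real.rpow_def_of_pos (by linarith)] at h2
    refine h2.trans ?_
    gcongr
    exact le_max_right _ _

theorem mulChiNeg4_natCast {q : ℕ} (χ : DirichletCharacter ℂ q) (n : ℕ) :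
    mulChiNeg4 χ (n : ZMod (4 * q)) = χ (n : ZMod q) * chiNeg4 (n : ZMod 4) := by
  by_cases h : n.Coprime (4 * q)
  · have h1 := DirichletCharacter.changeLevel_eq_cast_of_dvd χ (dvd_mul_left q 4) (ZMod.unitOfCoprime n h)
    have h2 := DirichletCharacter.changeLevel_eq_cast_of_dvd chiNeg4 (dvd_mul_right 4 q)
      (ZMod.unitOfCoprime n h)
    rw [ZMod.coe_unitOfCoprime] at h1 h2
    rw [mulChiNeg4, MulChar.mul_apply, h1, h2, ZMod.cast_natCast (dvd_mul_left q 4),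
      ZMod.cast_natCast (dvd_mul_right 4 q)]
  · rw [MulChar.map_nonunit _ (by rwa [ZMod.isUnit_iff_coprime])]
    rw [Nat.coprime_mul_iff_right, not_and_or] at h
    rcases h with h | h
    · rw [MulChar.map_nonunit chiNeg4 (by rwa [ZMod.isUnit_iff_coprime]), mul_zero]
    · rw [MulChar.map_nonunit χ (by rwa [ZMod.isUnit_iff_coprime]), zero_mul]

theorem chiNeg4_two : chiNeg4 ((2 : ℕ) : ZMod 4) = 0 := by
  have : ZMod.χ₄ ((2 : ℕ) : ZMod 4) = 0 := by decide
  rw [chiNeg4, MulChar.ringHomComp_apply, this, map_zero]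

theorem chiNeg4_of_one_mod_four {n : ℕ} (h : n % 4 = 1) : chiNeg4 (n : ZMod 4) = 1 := by
  rw [chiNeg4, MulChar.ringHomComp_apply, ZMod.χ₄_nat_one_mod_four h, map_one]

theorem chiNeg4_of_three_mod_four {n : ℕ} (h : n % 4 = 3) : chiNeg4 (n : ZMod 4) = -1 := by
  rw [chiNeg4, MulChar.ringHomComp_apply, ZMod.χ₄_nat_three_mod_four h, map_neg, map_one]

theorem isSum2Sq_iff {n : ℕ} :
    IsSum2Sq n ↔ ∀ p ∈ n.primeFactors, p % 4 = 3 → Even (padicValNat p n) := Nat.eq_sq_add_sq_iff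

theorem isSum2Sq_mul_iff {m n : ℕ} (hm : m ≠ 0) (hn : n ≠ 0) (h : m.Coprime n) :
    IsSum2Sq (m * n) ↔ IsSum2Sq m ∧ IsSum2Sq n := by
  simp only [isSum2Sq_iff, Nat.primeFactors_mul hm hn, Finset.mem_union, or_imp, forall_and]
  refine and_congr (forall₃_congr fun p hp _ => ?_) (forall₃_congr fun p hp _ => ?_)
  · have := Fact.mk (Nat.prime_of_mem_primeFactors hp)
    have h0 : ¬ p ∣ n := fun h' => Nat.Prime.one_lt this.out |>.ne'
      (Nat.eq_one_of_dvd_coprimes h (Nat.dvd_of_mem_primeFactors hp) h')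
    rw [padicValNat.mul hm hn, padicValNat.eq_zero_of_not_dvd h0, add_zero]
  · have := Fact.mk (Nat.prime_of_mem_primeFactors hp)
    have h0 : ¬ p ∣ m := fun h' => Nat.Prime.one_lt this.out |>.ne'
      (Nat.eq_one_of_dvd_coprimes h h' (Nat.dvd_of_mem_primeFactors hp))
    rw [padicValNat.mul hm hn, padicValNat.eq_zero_of_not_dvd h0, zero_add]

theorem isSum2Sq_prime_pow_iff {p : ℕ} (hp : p.Prime) (e : ℕ) :
    IsSum2Sq (p ^ e) ↔ (p % 4 = 3 → Even e) := by
  have := Fact.mk hp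
  rw [isSum2Sq_iff]
  rcases eq_or_ne e 0 with rfl | he
  · simp
  · rw [Nat.primeFactors_prime_pow he hp]
    simp

theorem term_STwist_mul {q : ℕ} (χ : DirichletCharacter ℂ q) (s : ℂ) {m n : ℕ} (h : m.Coprime n) :
    LSeries.term (STwist χ) s (m * n) = LSeries.term (STwist χ) s m * LSeries.term (STwist χ) s n := by
  rcases eq_or_ne m 0 with rfl | hm
  · simp
  rcases eq_or_ne n 0 with rfl | hn
  · simp
  rw [LSeries.term_of_ne_zero (mul_ne_zero hm hn), LSeries.term_of_ne_zero hm,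
    LSeries.term_of_ne_zero hn, Nat.cast_mul, natCast_mul_natCast_cpow, STwist, STwist, STwist,
    isSum2Sq_mul_iff hm hn h, Nat.cast_mul, map_mul]
  by_cases h1 : IsSum2Sq m <;> by_cases h2 : IsSum2Sq n <;> simp [h1, h2]
  ring

theorem norm_STwist_le {q : ℕ} (χ : DirichletCharacter ℂ q) (n : ℕ) : ‖STwist χ n‖ ≤ 1 := by
  rw [STwist]
  split_ifs
  · exact χ.norm_le_one _
  · simp

theorem LSeriesSummable_STwist {q : ℕ} (χ : DirichletCharacter ℂ q) {s : ℂ} (hs : 1 < s.re) :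
    LSeriesSummable (STwist χ) s :=
  LSeriesSummable_of_bounded_of_one_lt_re (fun n _ => norm_STwist_le χ n) hs

theorem natCast_pow_cpow (p e : ℕ) (s : ℂ) : ((p ^ e : ℕ) : ℂ) ^ s = ((p : ℂ) ^ s) ^ e := by
  induction e with
  | zero => simp
  | succ e ih => rw [pow_succ, Nat.cast_mul, natCast_mul_natCast_cpow, ih, pow_succ]

theorem term_STwist_prime_pow {q : ℕ} (χ : DirichletCharacter ℂ q) (s : ℂ) {p : ℕ} (hp : p.Prime)
    (e : ℕ) : LSeries.term (STwist χ) s (p ^ e) =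
      if p % 4 = 3 → Even e then (χ p * (p : ℂ) ^ (-s)) ^ e else 0 := by
  rw [LSeries.term_of_ne_zero (pow_ne_zero _ hp.ne_zero), STwist]
  simp only [isSum2Sq_prime_pow_iff hp]
  split_ifs
  · rw [natCast_pow_cpow, Nat.cast_pow, map_pow, cpow_neg, mul_pow, inv_pow, div_eq_mul_inv]
  · simp

theorem norm_mul_cpow_lt_one {q : ℕ} (χ : DirichletCharacter ℂ q) {s : ℂ} (hs : 0 < s.re) {p : ℕ}
    (hp : p.Prime) : ‖χ p * (p : ℂ) ^ (-s)‖ < 1 := by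
  rw [norm_mul, norm_natCast_cpow_of_pos hp.pos]
  refine mul_lt_one_of_nonneg_of_lt_one_right (χ.norm_le_one _) (by positivity) ?_
  exact Real.rpow_lt_one_of_one_lt_of_neg (by exact_mod_cast hp.one_lt) (by simpa using hs)

theorem tsum_term_STwist_prime_pow {q : ℕ} (χ : DirichletCharacter ℂ q) {s : ℂ} (hs : 0 < s.re)
    {p : ℕ} (hp : p.Prime) : ∑' e, LSeries.term (STwist χ) s (p ^ e) =
      if p % 4 = 3 then (1 - (χ p * (p : ℂ) ^ (-s)) ^ 2)⁻¹ else (1 - χ p * (p : ℂ) ^ (-s))⁻¹ := by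
  have hX := norm_mul_cpow_lt_one χ hs hp
  simp only [term_STwist_prime_pow χ s hp]
  set X := χ p * (p : ℂ) ^ (-s)
  split_ifs with h3
  · simp only [h3, true_imp_iff]
    have hg := hasSum_geometric_of_norm_lt_one (ξ := X ^ 2)
      (by rw [norm_pow]; exact pow_lt_one₀ (norm_nonneg _) hX two_ne_zero)
    have hinj : Function.Injective (fun n : ℕ => 2 * n) := fun a b h => by
      simpa using h
    refine HasSum.tsum_eq ((hinj.hasSum_iff ?_).1 (hg.congr_fun fun n => ?_))
    · intro n hn
      rw [if_neg]
      rintro ⟨k, rfl⟩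
      exact hn ⟨k, by simp [two_mul]⟩
    · simp [pow_mul]
  · simp only [h3, false_imp_iff, if_true]
    exact tsum_geometric_of_norm_lt_one hX

theorem hasProd_LSeries_STwist {q : ℕ} (χ : DirichletCharacter ℂ q) {s : ℂ} (hs : 1 < s.re) :
    HasProd (fun p : Nat.Primes => if (p : ℕ) % 4 = 3 then (1 - (χ (p : ℕ) * (p : ℂ) ^ (-s)) ^ 2)⁻¹
      else (1 - χ (p : ℕ) * (p : ℂ) ^ (-s))⁻¹) (LSeries (STwist χ) s) := by
  have h1 : LSeries.term (STwist χ) s 1 = 1 := by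
    have : IsSum2Sq 1 := ⟨1, 0, rfl⟩
    simp [LSeries.term_of_ne_zero, STwist, this]
  have := EulerProduct.eulerProduct_hasProd (f := LSeries.term (STwist χ) s) h1
    (term_STwist_mul χ s) (LSeriesSummable_STwist χ hs).norm (by simp)
  refine this.congr_fun fun p => ?_
  exact (tsum_term_STwist_prime_pow χ (by linarith) p.2).symm

/-- The completely multiplicative function supported on products of primes `p ≡ 3 (mod 4)`,
where it agrees with `χ ^ 4`. -/
def quarticTwist {q : ℕ} (χ : DirichletCharacter ℂ q) : ℕ →*₀ ℂ where
  toFun n := if ∀ p : ℕ, p.Prime → p ∣ n → p % 4 = 3 then χ n ^ 4 else 0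
  map_zero' := if_neg fun h => by simpa using h 2 Nat.prime_two (dvd_zero 2)
  map_one' := by
    rw [if_pos fun p hp h => absurd (Nat.dvd_one.1 h) hp.ne_one]
    simp
  map_mul' m n := by
    have : (∀ p : ℕ, p.Prime → p ∣ m * n → p % 4 = 3) ↔
        (∀ p : ℕ, p.Prime → p ∣ m → p % 4 = 3) ∧ (∀ p : ℕ, p.Prime → p ∣ n → p % 4 = 3) := by
      refine ⟨fun h => ⟨fun p hp hd => h p hp (hd.mul_right n), fun p hp hd => h p hp (hd.mul_left m)⟩,
        fun h p hp hd => ?_⟩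
      exact (hp.dvd_mul.1 hd).elim (h.1 p hp) (h.2 p hp)
    simp only [this, Nat.cast_mul, map_mul, mul_pow]
    by_cases h1 : ∀ p : ℕ, p.Prime → p ∣ m → p % 4 = 3
    · by_cases h2 : ∀ p : ℕ, p.Prime → p ∣ n → p % 4 = 3
      · rw [if_pos ⟨h1, h2⟩, if_pos h1, if_pos h2]
      · rw [if_neg fun h => h2 h.2, if_neg h2, mul_zero]
    · rw [if_neg fun h => h1 h.1, if_neg h1, zero_mul]

theorem quarticTwist_prime {q : ℕ} (χ : DirichletCharacter ℂ q) {p : ℕ} (hp : p.Prime) :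
    quarticTwist χ p = if p % 4 = 3 then χ p ^ 4 else 0 := by
  have : (∀ r : ℕ, r.Prime → r ∣ p → r % 4 = 3) ↔ p % 4 = 3 :=
    ⟨fun h => h p hp dvd_rfl, fun h r hr hd => by rwa [(Nat.prime_dvd_prime_iff_eq hr hp).1 hd]⟩
  change (if ∀ r : ℕ, r.Prime → r ∣ p → r % 4 = 3 then χ p ^ 4 else 0) = _
  simp only [this]

theorem norm_quarticTwist_le {q : ℕ} (χ : DirichletCharacter ℂ q) (n : ℕ) :
    ‖quarticTwist χ n‖ ≤ 1 := by
  change ‖if ∀ p : ℕ, p.Prime → p ∣ n → p % 4 = 3 then χ n ^ 4 else 0‖ ≤ 1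
  split_ifs
  · rw [norm_pow]
    exact pow_le_one₀ (norm_nonneg _) (χ.norm_le_one _)
  · simp

theorem LSeriesSummable_quarticTwist {q : ℕ} (χ : DirichletCharacter ℂ q) {s : ℂ} (hs : 1 < s.re) :
    LSeriesSummable (quarticTwist χ) s :=
  LSeriesSummable_of_bounded_of_one_lt_re (fun n _ => norm_quarticTwist_le χ n) hs

theorem hasProd_LSeries_quarticTwist {q : ℕ} (χ : DirichletCharacter ℂ q) {s : ℂ} (hs : 1 < s.re) :
    HasProd (fun p : Nat.Primes => if (p : ℕ) % 4 = 3 then (1 - χ (p : ℕ) ^ 4 * (p : ℂ) ^ (-s))⁻¹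
      else 1) (LSeries (quarticTwist χ) s) := by
  set f : ℕ →*₀ ℂ :=
    { toFun := fun n => LSeries.term (quarticTwist χ) s n
      map_zero' := by simp
      map_one' := by simp [LSeries.term_of_ne_zero]
      map_mul' := fun m n => by
        rcases eq_or_ne m 0 with rfl | hm
        · simp
        rcases eq_or_ne n 0 with rfl | hn
        · simp
        rw [LSeries.term_of_ne_zero (mul_ne_zero hm hn), LSeries.term_of_ne_zero hm,
          LSeries.term_of_ne_zero hn, Nat.cast_mul, natCast_mul_natCast_cpow, map_mul]
        ring } with hf
  have := EulerProduct.eulerProduct_completely_multiplicative_hasProd (f := f)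
    (LSeriesSummable_quarticTwist χ hs).norm
  refine this.congr_fun fun p => ?_
  have h1 : f p = quarticTwist χ p * (p : ℂ) ^ (-s) := by
    change LSeries.term (quarticTwist χ) s p = _
    rw [LSeries.term_of_ne_zero p.2.ne_zero, cpow_neg, div_eq_mul_inv]
  rw [h1, quarticTwist_prime χ p.2]
  split_ifs <;> simp

theorem hasProd_two (f : ℕ → ℂ) :
    HasProd (fun p : Nat.Primes => if (p : ℕ) = 2 then f p else 1) (f 2) := by
  have := hasProd_single (f := fun p : Nat.Primes => if (p : ℕ) = 2 then f p else 1)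
    ⟨2, Nat.prime_two⟩ (fun b hb => if_neg fun h => hb (Subtype.ext h))
  simpa using this

/-- The factorization of the fourth power of the Dirichlet series of `1_S χ`. -/
theorem LSeries_STwist_pow_four {q : ℕ} (χ : DirichletCharacter ℂ q) {s : ℂ} (hs : 1 < s.re) :
    LSeries (STwist χ) s ^ 4 * (1 - χ (2 : ℕ) * ((2 : ℕ) : ℂ) ^ (-s)) ^ 2 *
        LSeries (fun n => mulChiNeg4 (χ ^ 2) n) (2 * s) =
      LSeries (fun n => χ n) s ^ 2 * LSeries (fun n => mulChiNeg4 χ n) s ^ 2 *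
        LSeries (fun n => (χ ^ 2) n) (2 * s) * (1 - (χ (2 : ℕ) * ((2 : ℕ) : ℂ) ^ (-s)) ^ 2) *
        LSeries (quarticTwist χ) (4 * s) := by
  have h2s : 1 < (2 * s).re := by simp; linarith
  have h4s : 1 < (4 * s).re := by simp; linarith
  have hl := (((hasProd_LSeries_STwist χ hs).pow 4).mul
    (hasProd_two fun p => (1 - χ p * (p : ℂ) ^ (-s)) ^ 2)).mul
    (DirichletCharacter.LSeries_eulerProduct_hasProd (mulChiNeg4 (χ ^ 2)) h2s)
  have hr := ((((((DirichletCharacter.LSeries_eulerProduct_hasProd χ hs).pow 2).mul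
    ((DirichletCharacter.LSeries_eulerProduct_hasProd (mulChiNeg4 χ) hs).pow 2))).mul
    (DirichletCharacter.LSeries_eulerProduct_hasProd (χ ^ 2) h2s)).mul
    (hasProd_two fun p => 1 - (χ p * (p : ℂ) ^ (-s)) ^ 2)).mul (hasProd_LSeries_quarticTwist χ h4s)
  refine hl.unique (hr.congr_fun fun p => ?_)
  have hX := norm_mul_cpow_lt_one χ (by linarith : 0 < s.re) p.2
  have e2 : (χ ^ 2) ((p : ℕ) : ZMod q) * ((p : ℕ) : ℂ) ^ (-(2 * s)) =
      (χ (p : ℕ) * ((p : ℕ) : ℂ) ^ (-s)) ^ 2 := by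
    rw [MulChar.pow_apply' _ two_ne_zero, mul_pow, ← cpow_nat_mul]
    congr 2
    push_cast
    ring
  have e4 : χ ((p : ℕ) : ZMod q) ^ 4 * ((p : ℕ) : ℂ) ^ (-(4 * s)) =
      (χ (p : ℕ) * ((p : ℕ) : ℂ) ^ (-s)) ^ 4 := by
    rw [mul_pow, ← cpow_nat_mul]
    congr 2
    push_cast
    ring
  simp only [mulChiNeg4_natCast, e4, mul_right_comm _ (chiNeg4 _), e2]
  generalize χ ((p : ℕ) : ZMod q) * ((p : ℕ) : ℂ) ^ (-s) = X at hX
  have hne : ∀ Y : ℂ, ‖Y‖ < 1 → 1 - Y ≠ 0 := fun Y hY h => by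
    rw [← sub_eq_zero.1 h, norm_one] at hY
    exact lt_irrefl _ hY
  have n1 := hne X hX
  have hX2 : ‖X ^ 2‖ < 1 := by rw [norm_pow]; exact pow_lt_one₀ (norm_nonneg _) hX two_ne_zero
  have n2 := hne (X ^ 2) hX2
  rcases p.2.eq_two_or_odd with h | h
  · rw [h, chiNeg4_two]
    simp only [mul_zero, sub_zero, inv_one, if_true]
    norm_num
    field_simp
  · have hp2 : (p : ℕ) ≠ 2 := by intro h'; rw [h'] at h; norm_num at h
    rcases (by omega : (p : ℕ) % 4 = 1 ∨ (p : ℕ) % 4 = 3) with h4 | h4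
    · rw [chiNeg4_of_one_mod_four h4]
      simp only [h4, hp2, if_false, mul_one]
      norm_num
      left
      generalize 1 - X = a
      ring
    · rw [chiNeg4_of_three_mod_four h4]
      simp only [h4, hp2, if_false, mul_neg, mul_one, if_true]
      rw [show 1 - X ^ 4 = (1 - X ^ 2) * (1 - -X ^ 2) by ring,
        show (1 - X ^ 2) = (1 - X) * (1 - -X) by ring]
      generalize 1 - X = a
      generalize 1 - -X = b
      generalize 1 - -X ^ 2 = d
      simp only [mul_inv, mul_pow]
      ring

theorem LVal_eq {N : ℕ} [h : NeZero N] (ψ : DirichletCharacter ℂ N) (s : ℂ) :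
    LVal ψ s = ZMod.LFunction ψ s := by
  rw [LVal, dif_neg h.out]
  rfl

theorem differentiableAt_LVal {N : ℕ} [NeZero N] (ψ : DirichletCharacter ℂ N) {s : ℂ} (hs : s ≠ 1) :
    DifferentiableAt ℂ (LVal ψ) s := by
  have : LVal ψ = ZMod.LFunction ψ := funext (LVal_eq ψ)
  rw [this]
  exact ZMod.differentiableAt_LFunction ψ s (Or.inl hs)

/-- The product `L(s, χ) L(s, χ χ₋₄)`. -/
def LProd {q : ℕ} (χ : DirichletCharacter ℂ q) (s : ℂ) : ℂ := LVal χ s * LVal (mulChiNeg4 χ) s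

/-- The denominator in the factorization of `F(s, χ) ^ 4`. -/
def factorDen {q : ℕ} (χ : DirichletCharacter ℂ q) (s : ℂ) : ℂ :=
  (1 - χ (2 : ℕ) * ((2 : ℕ) : ℂ) ^ (-s)) ^ 2 * LVal (mulChiNeg4 (χ ^ 2)) (2 * s)

/-- The numerator in the factorization of `F(s, χ) ^ 4`. -/
def factorNum {q : ℕ} (χ : DirichletCharacter ℂ q) (s : ℂ) : ℂ :=
  LProd χ s ^ 2 * (LVal (χ ^ 2) (2 * s) * (1 - (χ (2 : ℕ) * ((2 : ℕ) : ℂ) ^ (-s)) ^ 2) *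
    LSeries (quarticTwist χ) (4 * s))

theorem ne_one_of_im_ne_zero {s : ℂ} (hs : s.im ≠ 0) : s ≠ 1 := by
  rintro rfl
  exact hs one_im

theorem two_mul_ne_one_of_im_ne_zero {s : ℂ} (hs : s.im ≠ 0) : 2 * s ≠ 1 :=
  ne_one_of_im_ne_zero (by simpa using hs)

section

variable {q : ℕ} (χ : DirichletCharacter ℂ q)

theorem differentiableAt_LProd [NeZero q] {s : ℂ} (hs : s ≠ 1) : DifferentiableAt ℂ (LProd χ) s :=
  (differentiableAt_LVal χ hs).mul (differentiableAt_LVal (mulChiNeg4 χ) hs)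

theorem differentiableAt_mul_two_cpow (s : ℂ) :
    DifferentiableAt ℂ (fun s : ℂ => χ (2 : ℕ) * ((2 : ℕ) : ℂ) ^ (-s)) s :=
  (differentiableAt_id.neg.const_cpow (Or.inl (by norm_num))).const_mul _

theorem differentiableAt_factorDen [NeZero q] {s : ℂ} (hs : s.im ≠ 0) : DifferentiableAt ℂ (factorDen χ) s := by
  have h := differentiableAt_LVal (mulChiNeg4 (χ ^ 2)) (two_mul_ne_one_of_im_ne_zero hs)
  exact (((differentiableAt_const 1).sub (differentiableAt_mul_two_cpow χ s)).pow 2).mul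
    (h.comp s (differentiableAt_id.const_mul 2))

theorem differentiableAt_LSeries_quarticTwist {s : ℂ} (hs : 1 < s.re) :
    DifferentiableAt ℂ (LSeries (quarticTwist χ)) s := by
  refine (LSeries_analyticOnNhd (quarticTwist χ) s ?_).differentiableAt
  have := LSeries.abscissaOfAbsConv_le_of_le_const (f := quarticTwist χ)
    ⟨1, fun n _ => norm_quarticTwist_le χ n⟩
  exact this.trans_lt (by exact_mod_cast hs)

theorem differentiableAt_factorNum [NeZero q] {s : ℂ} (hs : s.im ≠ 0) (hs' : 1 / 4 < s.re) :
    DifferentiableAt ℂ (factorNum χ) s := by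
  have h1 := differentiableAt_LVal (χ ^ 2) (two_mul_ne_one_of_im_ne_zero hs)
  have h2 : DifferentiableAt ℂ (LSeries (quarticTwist χ)) (4 * s) :=
    differentiableAt_LSeries_quarticTwist χ (by simp; linarith)
  refine ((differentiableAt_LProd χ (ne_one_of_im_ne_zero hs)).pow 2).mul
    (((h1.comp s (differentiableAt_id.const_mul 2)).mul
    ((differentiableAt_const 1).sub ((differentiableAt_mul_two_cpow χ s).pow 2))).mul
    (h2.comp s (differentiableAt_id.const_mul 4)))

variable {χ}

theorem one_sub_mul_two_cpow_ne_zero {s : ℂ} (hs : 0 < s.re) :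
    1 - χ (2 : ℕ) * ((2 : ℕ) : ℂ) ^ (-s) ≠ 0 := fun h => by
  have := norm_mul_cpow_lt_one χ hs Nat.prime_two
  rw [← sub_eq_zero.1 h, norm_one] at this
  exact lt_irrefl _ this

theorem factorDen_ne_zero [NeZero q] (h4 : GRH (mulChiNeg4 (χ ^ 2))) {s : ℂ} (hs : s.im ≠ 0)
    (hs' : 1 / 4 < s.re) : factorDen χ s ≠ 0 := by
  refine mul_ne_zero (pow_ne_zero _ (one_sub_mul_two_cpow_ne_zero (by linarith))) ?_
  rw [LVal_eq]
  exact LFunction_ne_zero_of_GRH h4 (by simp; linarith) (two_mul_ne_one_of_im_ne_zero hs)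

theorem LProd_ne_zero [NeZero q] (h1 : GRH χ) (h2 : GRH (mulChiNeg4 χ)) {s : ℂ} (hs : s ≠ 1)
    (hs' : 1 / 2 < s.re) : LProd χ s ≠ 0 := by
  rw [LProd, LVal_eq, LVal_eq]
  exact mul_ne_zero (LFunction_ne_zero_of_GRH h1 hs' hs) (LFunction_ne_zero_of_GRH h2 hs' hs)

theorem half_add_mul_I_ne_one (t : ℝ) : (1 / 2 + t * I : ℂ) ≠ 1 := by
  intro h
  have := congrArg Complex.re h
  norm_num at this

theorem continuous_LProd_half [NeZero q] : Continuous fun t : ℝ => LProd χ (1 / 2 + t * I) := by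
  refine continuous_iff_continuousAt.2 fun t => ?_
  exact (differentiableAt_LProd χ (half_add_mul_I_ne_one t)).continuousAt.comp
    (f := fun t : ℝ => (1 / 2 + t * I : ℂ)) (by fun_prop)

/-- The zeros of `L(s, χ) L(s, χ χ₋₄)` on the critical line are isolated. -/
theorem eventually_LProd_half_ne_zero [NeZero q] (h1 : GRH χ) (h2 : GRH (mulChiNeg4 χ)) (t₀ : ℝ) :
    ∀ᶠ t : ℝ in nhdsWithin t₀ {t₀}ᶜ, LProd χ (1 / 2 + t * I) ≠ 0 := by
  set z₀ : ℂ := 1 / 2 + t₀ * I with hz₀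
  have han : AnalyticAt ℂ (LProd χ) z₀ := by
    refine DifferentiableOn.analyticAt (s := {1}ᶜ) (fun z hz => ?_)
      (isOpen_compl_singleton.mem_nhds (half_add_mul_I_ne_one t₀))
    exact (differentiableAt_LProd χ hz).differentiableWithinAt
  rcases han.eventually_eq_zero_or_eventually_ne_zero with h | h
  · exfalso
    have ht : Tendsto (fun u : ℝ => z₀ + u) (nhdsWithin 0 (Set.Ioi 0)) (nhds z₀) := by
      have : Tendsto (fun u : ℝ => z₀ + u) (nhds 0) (nhds (z₀ + (0 : ℝ))) :=
        Continuous.tendsto (by fun_prop) 0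
      simpa using this.mono_left nhdsWithin_le_nhds
    have hlt : ∀ᶠ u : ℝ in nhdsWithin 0 (Set.Ioi 0), u < 1 / 2 :=
      nhdsWithin_le_nhds (Iio_mem_nhds (by norm_num))
    have hgt : ∀ᶠ u : ℝ in nhdsWithin 0 (Set.Ioi 0), 0 < u := self_mem_nhdsWithin
    obtain ⟨u, hu1, hu2, hu3⟩ := ((ht.eventually h).and (hgt.and hlt)).exists
    have hre : (z₀ + u).re = 1 / 2 + u := by simp [hz₀]
    refine LProd_ne_zero h1 h2 (fun h => ?_) ?_ hu1
    · rw [h, one_re] at hre; linarith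
    · rw [hre]; linarith
  · have hcont : Tendsto (fun t : ℝ => (1 / 2 + t * I : ℂ)) (nhdsWithin t₀ {t₀}ᶜ)
        (nhdsWithin z₀ {z₀}ᶜ) := by
      refine tendsto_nhdsWithin_of_tendsto_nhds_of_eventually_within _ ?_ ?_
      · have : Continuous fun t : ℝ => (1 / 2 + t * I : ℂ) := by fun_prop
        exact (this.tendsto t₀).mono_left nhdsWithin_le_nhds
      · filter_upwards [self_mem_nhdsWithin] with t ht h
        apply ht
        have := congrArg Complex.im (h : (1 / 2 + t * I : ℂ) = z₀)
        simpa [hz₀] using this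
    exact hcont.eventually h

theorem exists_LProd_half_ne_zero [NeZero q] (h1 : GRH χ) (h2 : GRH (mulChiNeg4 χ)) (t₀ : ℝ) :
    ∃ δ, 0 < δ ∧ ∀ t : ℝ, t ≠ t₀ → |t - t₀| < δ → LProd χ (1 / 2 + t * I) ≠ 0 := by
  have h := eventually_LProd_half_ne_zero h1 h2 t₀
  rw [eventually_nhdsWithin_iff, Metric.eventually_nhds_iff] at h
  obtain ⟨δ, hδ, h⟩ := h
  exact ⟨δ, hδ, fun t ht htd => h (by rwa [Real.dist_eq]) ht⟩

/-- The region to the right of `Re s = 1/4`, on one side of the real axis, slit along the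
horizontal half-lines ending at the zeros on the critical line. -/
def slitRegion (χ : DirichletCharacter ℂ q) (γ : ℝ) : Set ℂ :=
  {s | 1 / 4 < s.re ∧ (s.re ≤ 1 / 2 → LProd χ (1 / 2 + s.im * I) ≠ 0) ∧ 0 < γ * s.im}

theorem isOpen_slitRegion [NeZero q] (γ : ℝ) : IsOpen (slitRegion χ γ) := by
  have : slitRegion χ γ = {s | 1 / 4 < s.re} ∩ (({s | 1 / 2 < s.re} ∪
      {s | LProd χ (1 / 2 + s.im * I) ≠ 0}) ∩ {s | 0 < γ * s.im}) := by
    ext s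
    simp only [slitRegion, Set.mem_ofPred_eq, Set.mem_inter_iff, Set.mem_union, ← not_lt, imp_iff_not_or,
      not_not]
  rw [this]
  refine (isOpen_lt continuous_const continuous_re).inter
    (((isOpen_lt continuous_const continuous_re).union ?_).inter
      (isOpen_lt continuous_const (continuous_const.mul continuous_im)))
  exact isOpen_ne_fun (continuous_LProd_half.comp continuous_im) continuous_const

theorem isPreconnected_slitRegion {γ : ℝ} (hγ : γ ≠ 0) : IsPreconnected (slitRegion χ γ) := by
  refine isPreconnected_of_forall (2 + γ * I : ℂ) fun y hy => ?_
  obtain ⟨hy1, hy2, hy3⟩ := hy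
  have hconv1 : Convex ℝ ({s : ℂ | 1 / 2 < s.re} ∩ {s : ℂ | 0 < γ * s.im}) := by
    refine (convex_halfSpace_re_gt _).inter ?_
    exact (convex_Ioi (0 : ℝ)).linear_preimage (γ • imLm)
  have hconv2 : Convex ℝ ({s : ℂ | y.re ≤ s.re} ∩ {s : ℂ | s.im = y.im}) := by
    refine (convex_halfSpace_re_ge _).inter ?_
    exact (convex_singleton y.im).linear_preimage imLm
  refine ⟨_, ?_, ?_, ?_, hconv1.isPreconnected.union (((max y.re 1 : ℝ) : ℂ) + y.im * I) ?_ ?_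
    hconv2.isPreconnected⟩
  · rintro s (⟨hs1, hs2⟩ | ⟨hs1, hs2⟩)
    · simp only [Set.mem_ofPred_eq] at hs1 hs2
      exact ⟨by linarith, fun h => by linarith, hs2⟩
    · simp only [Set.mem_ofPred_eq] at hs1 hs2
      refine ⟨by linarith, fun h => ?_, ?_⟩ <;> rw [hs2]
      · exact hy2 (by linarith)
      · exact hy3
  · left
    simp only [Set.mem_inter_iff, Set.mem_ofPred_eq]
    constructor
    · simp; norm_num
    · simp; positivity
  · right
    exact ⟨le_refl y.re, rfl⟩
  · simp only [Set.mem_inter_iff, Set.mem_ofPred_eq]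
    constructor
    · simp; norm_num
    · simpa using hy3
  · simp only [Set.mem_inter_iff, Set.mem_ofPred_eq]
    constructor <;> simp

/-- The factorization of `F ^ 4`, continued to the slit region. -/
theorem pow_four_mul_factorDen [NeZero q] {F : ℂ → ℂ}
    (hFser : ∀ s : ℂ, 1 < s.re → F s = LSeries (STwist χ) s)
    (hFan : DifferentiableOn ℂ F {s : ℂ | 1 / 4 < s.re ∧ (s.re ≤ 1 / 2 →
      LVal χ (1 / 2 + s.im * I) * LVal (mulChiNeg4 χ) (1 / 2 + s.im * I) ≠ 0 ∧
      ¬(s.im = 0 ∧ (χ ^ 2 = 1 ∨ mulChiNeg4 (χ ^ 2) = 1)))})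
    {s : ℂ} (hs : 1 / 4 < s.re) (hs0 : s.im ≠ 0)
    (hs' : s.re ≤ 1 / 2 → LProd χ (1 / 2 + s.im * I) ≠ 0) :
    F s ^ 4 * factorDen χ s = factorNum χ s := by
  set U := slitRegion χ s.im with hU
  have hUo : IsOpen U := isOpen_slitRegion s.im
  have him : ∀ z ∈ U, z.im ≠ 0 := fun z hz h => by
    have := hz.2.2
    rw [h, mul_zero] at this
    exact lt_irrefl _ this
  have hF : DifferentiableOn ℂ F U := hFan.mono fun z hz =>
    ⟨hz.1, fun h => ⟨hz.2.1 h, fun h' => him z hz h'.1⟩⟩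
  have hl : AnalyticOnNhd ℂ (fun z => F z ^ 4 * factorDen χ z) U :=
    DifferentiableOn.analyticOnNhd ((hF.pow 4).mul fun z hz =>
      (differentiableAt_factorDen χ (him z hz)).differentiableWithinAt) hUo
  have hr : AnalyticOnNhd ℂ (factorNum χ) U :=
    DifferentiableOn.analyticOnNhd (fun z hz =>
      (differentiableAt_factorNum χ (him z hz) hz.1).differentiableWithinAt) hUo
  have hbase : (2 + s.im * I : ℂ) ∈ U :=
    ⟨by simp; norm_num, fun h => absurd h (by simp; norm_num), by simpa using mul_self_pos.2 hs0⟩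
  refine hl.eqOn_of_preconnected_of_eventuallyEq hr (isPreconnected_slitRegion hs0) hbase ?_
    ⟨hs, hs', mul_self_pos.2 hs0⟩
  have hre : ∀ᶠ z in nhds (2 + s.im * I : ℂ), 1 < z.re :=
    (isOpen_lt continuous_const continuous_re).mem_nhds (by simp)
  filter_upwards [hre] with z hz
  have h := LSeries_STwist_pow_four χ hz
  have h2z : 1 < (2 * z).re := by simp; linarith
  rw [hFser z hz, factorDen, factorNum, LProd, LVal_eq, LVal_eq, LVal_eq, LVal_eq,
    ZMod.LFunction_eq_LSeries χ hz, ZMod.LFunction_eq_LSeries (mulChiNeg4 χ) hz,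
    ZMod.LFunction_eq_LSeries (χ ^ 2 : DirichletCharacter ℂ q) h2z,
    ZMod.LFunction_eq_LSeries (mulChiNeg4 (χ ^ 2)) h2z]
  linear_combination h

/-- The continuous function equal to `|F(s, χ)|` off the slits. -/
def absF (χ : DirichletCharacter ℂ q) (s : ℂ) : ℝ :=
  (‖factorNum χ s‖ / ‖factorDen χ s‖) ^ (1 / 4 : ℝ)

theorem continuousAt_absF [NeZero q] (h4 : GRH (mulChiNeg4 (χ ^ 2))) {s : ℂ} (hs : 1 / 4 < s.re)
    (hs0 : s.im ≠ 0) : ContinuousAt (absF χ) s := by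
  refine ContinuousAt.rpow_const ?_ (Or.inr (by norm_num))
  exact (differentiableAt_factorNum χ hs0 hs).continuousAt.norm.div
    (differentiableAt_factorDen χ hs0).continuousAt.norm
    (norm_ne_zero_iff.2 (factorDen_ne_zero h4 hs0 hs))

theorem norm_eq_absF [NeZero q] (h4 : GRH (mulChiNeg4 (χ ^ 2))) {F : ℂ → ℂ}
    (hFser : ∀ s : ℂ, 1 < s.re → F s = LSeries (STwist χ) s)
    (hFan : DifferentiableOn ℂ F {s : ℂ | 1 / 4 < s.re ∧ (s.re ≤ 1 / 2 →
      LVal χ (1 / 2 + s.im * I) * LVal (mulChiNeg4 χ) (1 / 2 + s.im * I) ≠ 0 ∧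
      ¬(s.im = 0 ∧ (χ ^ 2 = 1 ∨ mulChiNeg4 (χ ^ 2) = 1)))})
    {s : ℂ} (hs : 1 / 4 < s.re) (hs0 : s.im ≠ 0)
    (hs' : s.re ≤ 1 / 2 → LProd χ (1 / 2 + s.im * I) ≠ 0) : ‖F s‖ = absF χ s := by
  have h := pow_four_mul_factorDen hFser hFan hs hs0 hs'
  have hA : 0 < ‖factorDen χ s‖ := norm_pos_iff.2 (factorDen_ne_zero h4 hs0 hs)
  rw [absF, ← h, norm_mul, mul_div_assoc, div_self hA.ne', mul_one, norm_pow, ← Real.rpow_natCast,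
    ← Real.rpow_mul (norm_nonneg _)]
  norm_num

end

theorem rpow_le_four_rpow_mul_rpow {a b e : ℝ} (ha : 0 ≤ a) (hb : 0 ≤ b) (hba : b ≤ 4 * a)
    (he : 0 ≤ e) : b ^ e ≤ 4 ^ e * a ^ e := by
  rw [← Real.mul_rpow (by norm_num) ha]
  exact Real.rpow_le_rpow hb hba he

theorem abs_le_of_abs_sub_le_one {t γ : ℝ} (h : |t - γ| ≤ 1) : |t| ≤ |γ| + 1 := by
  have := abs_add_le (t - γ) γ
  rw [sub_add_cancel] at this
  linarith

section

variable {q : ℕ} {χ : DirichletCharacter ℂ q}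

theorem exists_norm_LProd_le [NeZero q] (h1 : GRH χ) (h2 : GRH (mulChiNeg4 χ)) {c η t₀ : ℝ} (hc : 0 < c)
    (hc1 : c < 1) (hη : 0 < η) (ht₀ : 0 < t₀) :
    ∃ C, 0 < C ∧ ∀ (γ : ℝ) (s : ℂ), 1 / 2 - c ≤ s.re → s.re ≤ 3 / 2 → t₀ ≤ |s.im| →
      |s.im - γ| ≤ 1 → ‖LProd χ s‖ ≤ C * (1 + |γ|) ^ (2 * (c + η)) := by
  obtain ⟨C₁, hC₁, H₁⟩ := h1.exists_norm_LFunction_le hc hc1 hη ht₀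
  obtain ⟨C₂, hC₂, H₂⟩ := h2.exists_norm_LFunction_le hc hc1 hη ht₀
  refine ⟨(C₁ * 4 ^ (c + η)) * (C₂ * 4 ^ (c + η)), by positivity, fun γ s hs hs' ht hγ => ?_⟩
  have hA : (0 : ℝ) < 1 + |γ| := by positivity
  have hb := rpow_le_four_rpow_mul_rpow (b := 1 + |s.im|) (e := c + η) hA.le (by positivity)
    (by linarith [abs_le_of_abs_sub_le_one hγ, abs_nonneg γ]) (by positivity)
  rw [LProd, LVal_eq, LVal_eq, norm_mul, two_mul, Real.rpow_add hA]
  calc _ ≤ (C₁ * (4 ^ (c + η) * (1 + |γ|) ^ (c + η))) * (C₂ * (4 ^ (c + η) * (1 + |γ|) ^ (c + η))) :=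
        mul_le_mul ((H₁ s hs hs' ht).trans (by gcongr)) ((H₂ s hs hs' ht).trans (by gcongr))
          (norm_nonneg _) (by positivity)
    _ = _ := by ring

/-- The bound for `L(s, χ) L(s, χ χ₋₄)` near a zero `1 / 2 + i γ`, from the Schwarz lemma. -/
theorem exists_norm_LProd_le_mul_norm_sub [NeZero q] (h1 : GRH χ) (h2 : GRH (mulChiNeg4 χ)) {c η κ : ℝ}
    (hκ : 0 < κ) (hκc : κ ≤ c) (hc1 : c < 1) (hη : 0 < η) :
    ∃ C, 0 < C ∧ ∀ (γ : ℝ) (s : ℂ), 2 * κ ≤ |γ| → LProd χ (1 / 2 + γ * I) = 0 →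
      1 / 2 - c ≤ s.re → s.re ≤ 3 / 2 → |s.im - γ| ≤ κ →
      ‖LProd χ s‖ ≤ C * ‖s - (1 / 2 + γ * I)‖ * (1 + |γ|) ^ (2 * (c + η)) := by
  obtain ⟨C, hC, H⟩ := exists_norm_LProd_le h1 h2 (hκ.trans_le hκc) hc1 hη hκ
  refine ⟨C / κ, by positivity, fun γ s hγ hzero hs hs' ht => ?_⟩
  have him : ∀ t : ℝ, |t - γ| ≤ κ → κ ≤ |t| := fun t ht => by
    have := abs_sub_abs_le_abs_sub γ t
    rw [abs_sub_comm] at this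
    linarith
  set ρ : ℂ := 1 / 2 + γ * I with hρ
  have hρre : ρ.re = 1 / 2 := by simp [hρ]
  have hρim : ρ.im = γ := by simp [hρ]
  by_cases hball : s ∈ Metric.ball ρ κ
  · have hz : ∀ z ∈ Metric.ball ρ κ, |z.re - 1 / 2| < κ ∧ |z.im - γ| < κ := fun z hz => by
      rw [mem_ball_iff_norm] at hz
      have hr := (abs_re_le_norm (z - ρ)).trans_lt hz
      have hi := (abs_im_le_norm (z - ρ)).trans_lt hz
      rw [sub_re, hρre] at hr
      rw [sub_im, hρim] at hi
      exact ⟨hr, hi⟩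
    have hd : DifferentiableOn ℂ (LProd χ) (Metric.ball ρ κ) := fun z hzb =>
      (differentiableAt_LProd χ (ne_one_of_im_ne_zero (abs_pos.1
        (hκ.trans_le (him _ (hz z hzb).2.le))))).differentiableWithinAt
    have hmaps : Set.MapsTo (LProd χ) (Metric.ball ρ κ)
        (Metric.closedBall (LProd χ ρ) (C * (1 + |γ|) ^ (2 * (c + η)))) := fun z hzb => by
      obtain ⟨hr, hi⟩ := hz z hzb
      rw [abs_lt] at hr
      rw [hzero, mem_closedBall_zero_iff]
      exact H γ z (by linarith) (by linarith) (him _ hi.le) (by linarith)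
    have := dist_le_div_mul_dist_of_mapsTo_ball hd hmaps hball
    rw [hzero, dist_zero_right, dist_eq_norm] at this
    exact this.trans_eq (by ring)
  · rw [mem_ball_iff_norm, not_lt] at hball
    refine (H γ s hs hs' (him _ ht) (by linarith)).trans ?_
    have : 1 ≤ ‖s - ρ‖ / κ := (one_le_div hκ).2 hball
    calc _ = C * 1 * (1 + |γ|) ^ (2 * (c + η)) := by ring
      _ ≤ C * (‖s - ρ‖ / κ) * (1 + |γ|) ^ (2 * (c + η)) := by gcongr
      _ = _ := by ring

theorem exists_norm_LSeries_quarticTwist_le :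
    ∃ C, 0 < C ∧ ∀ s : ℂ, 3 / 2 ≤ s.re → ‖LSeries (quarticTwist χ) s‖ ≤ C := by
  have hsum : LSeriesSummable (quarticTwist χ) ((3 / 2 : ℝ) : ℂ) :=
    LSeriesSummable_quarticTwist χ (by rw [ofReal_re]; norm_num)
  refine ⟨(∑' n, ‖LSeries.term (quarticTwist χ) ((3 / 2 : ℝ) : ℂ) n‖) + 1, ?_, fun s hs => ?_⟩
  · have : 0 ≤ ∑' n, ‖LSeries.term (quarticTwist χ) ((3 / 2 : ℝ) : ℂ) n‖ :=
      tsum_nonneg fun n => norm_nonneg _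
    linarith
  · have hle := LSeries.norm_term_le_of_re_le_re (quarticTwist χ) (s := ((3 / 2 : ℝ) : ℂ)) (s' := s)
      (by rwa [ofReal_re])
    have := tsum_of_norm_bounded hsum.norm.hasSum hle
    rw [LSeries]
    linarith

theorem exists_norm_factor_le [NeZero q] (h3 : GRH (χ ^ 2)) (h4 : GRH (mulChiNeg4 (χ ^ 2))) {η κ : ℝ}
    (hη : 0 < η) (hη1 : η < 1) (hκ : 0 < κ) :
    ∃ C, 0 < C ∧ ∀ (γ : ℝ) (s : ℂ), 3 / 8 ≤ s.re → s.re ≤ 3 / 4 → κ ≤ |s.im| → |s.im - γ| ≤ 1 →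
      ‖LVal (χ ^ 2) (2 * s) * (1 - (χ (2 : ℕ) * ((2 : ℕ) : ℂ) ^ (-s)) ^ 2) *
        LSeries (quarticTwist χ) (4 * s)‖ * ‖factorDen χ s‖⁻¹ ≤ C * (1 + |γ|) ^ (3 * η) := by
  obtain ⟨C₁, hC₁, H₁⟩ := h3.exists_norm_LFunction_le hη hη1 hη hκ
  obtain ⟨C₂, hC₂, H₂⟩ := h4.exists_norm_LFunction_ge hη hκ
  obtain ⟨C₃, hC₃, H₃⟩ := exists_norm_LSeries_quarticTwist_le (χ := χ)
  set b : ℝ := 2 ^ (-(3 / 8) : ℝ) with hb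
  have hb0 : 0 < b := by positivity
  have hb1 : 0 < 1 - b := sub_pos.2 (Real.rpow_lt_one_of_one_lt_of_neg (by norm_num) (by norm_num))
  refine ⟨(C₁ * 4 ^ (η + η)) * 2 * C₃ * (((1 - b) ^ 2)⁻¹ * (C₂ * 4 ^ η)), by positivity,
    fun γ s hs hs' ht hγ => ?_⟩
  have hA : (0 : ℝ) < 1 + |γ| := by positivity
  have h2im : |(2 * s).im| = 2 * |s.im| := by simp [abs_mul]
  have h2re : (2 * s).re = 2 * s.re := by simp
  have h4re : (4 * s).re = 4 * s.re := by simp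
  have hle : 1 + |(2 * s).im| ≤ 4 * (1 + |γ|) := by
    rw [h2im]
    linarith [abs_le_of_abs_sub_le_one hγ, abs_nonneg γ]
  have h2κ : κ ≤ |(2 * s).im| := by rw [h2im]; linarith
  set X : ℂ := χ (2 : ℕ) * ((2 : ℕ) : ℂ) ^ (-s) with hX
  have hXb : ‖X‖ ≤ b := by
    rw [hX, norm_mul, norm_natCast_cpow_of_pos two_pos, neg_re]
    calc _ ≤ 1 * (2 : ℝ) ^ (-(3 / 8) : ℝ) := by
          refine mul_le_mul (χ.norm_le_one _) ?_ (by positivity) one_pos.le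
          exact Real.rpow_le_rpow_of_exponent_le (by norm_num) (by linarith)
      _ = b := one_mul _
  have e1 : ‖LVal (χ ^ 2) (2 * s)‖ ≤ C₁ * (4 ^ (η + η) * (1 + |γ|) ^ (η + η)) := by
    rw [LVal_eq]
    refine (H₁ (2 * s) (by linarith) (by linarith) h2κ).trans ?_
    have := rpow_le_four_rpow_mul_rpow hA.le (by positivity) hle (add_pos hη hη).le
    gcongr
  have e2 : ‖1 - X ^ 2‖ ≤ 2 := by
    refine (norm_sub_le _ _).trans ?_
    rw [norm_one, norm_pow]
    nlinarith [norm_nonneg X]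
  have e3 := H₃ (4 * s) (by linarith)
  have e4 : ‖factorDen χ s‖⁻¹ ≤ ((1 - b) ^ 2)⁻¹ * (C₂ * (4 ^ η * (1 + |γ|) ^ η)) := by
    rw [factorDen, norm_mul, norm_pow, mul_inv, ← hX, LVal_eq]
    have h1X : 1 - b ≤ ‖1 - X‖ := by
      have := norm_sub_norm_le 1 X
      rw [norm_one] at this
      linarith
    have := rpow_le_four_rpow_mul_rpow hA.le (by positivity) hle hη.le
    have hL := (H₂ (2 * s) (by linarith) (by linarith) h2κ).trans
      (mul_le_mul_of_nonneg_left this hC₂.le)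
    gcongr
  have e5 : (1 + |γ|) ^ (3 * η) = (1 + |γ|) ^ (η + η) * (1 + |γ|) ^ η := by
    rw [← Real.rpow_add hA]; ring_nf
  rw [norm_mul, norm_mul]
  calc _ ≤ (C₁ * (4 ^ (η + η) * (1 + |γ|) ^ (η + η))) * 2 * C₃ *
        (((1 - b) ^ 2)⁻¹ * (C₂ * (4 ^ η * (1 + |γ|) ^ η))) := by gcongr
    _ = _ := by rw [e5]; ring

/-- The bound for `|F(s, χ)|` near a zero `1 / 2 + i γ` of `L(s, χ) L(s, χ χ₋₄)`. -/
theorem exists_absF_le [NeZero q] (h1 : GRH χ) (h2 : GRH (mulChiNeg4 χ)) (h3 : GRH (χ ^ 2))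
    (h4 : GRH (mulChiNeg4 (χ ^ 2))) {c ε κ : ℝ} (hκ : 0 < κ) (hκc : κ ≤ c) (hc1 : c < 1 / 8)
    (hε : 0 < ε) :
    ∃ C, 0 < C ∧ ∀ (γ : ℝ) (s : ℂ), 2 * κ ≤ |γ| → LProd χ (1 / 2 + γ * I) = 0 →
      1 / 2 - c ≤ s.re → s.re ≤ 3 / 4 → |s.im - γ| ≤ κ →
      absF χ s ≤ C * ‖s - (1 / 2 + γ * I)‖ ^ (1 / 2 : ℝ) * (1 + |γ|) ^ (c + ε) := by
  set η : ℝ := min (ε / 2) (1 / 2) with hη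
  have hη0 : 0 < η := lt_min (by positivity) (by norm_num)
  have hη1 : η ≤ ε / 2 := min_le_left _ _
  have hη2 : η ≤ 1 / 2 := min_le_right _ _
  obtain ⟨C₁, hC₁, H₁⟩ := exists_norm_LProd_le_mul_norm_sub h1 h2 hκ hκc (by linarith) hη0
  obtain ⟨C₂, hC₂, H₂⟩ := exists_norm_factor_le h3 h4 hη0 (by linarith) hκ
  refine ⟨(C₁ ^ 2 * C₂) ^ (1 / 4 : ℝ), by positivity, fun γ s hγ hzero hs hs' ht => ?_⟩
  set d := ‖s - (1 / 2 + γ * I)‖ with hd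
  have hd0 : 0 ≤ d := norm_nonneg _
  have hA : (0 : ℝ) < 1 + |γ| := by positivity
  have him : κ ≤ |s.im| := by
    have := abs_sub_abs_le_abs_sub γ s.im
    rw [abs_sub_comm] at this
    linarith
  have b1 := H₁ γ s hγ hzero hs (by linarith) ht
  have b2 := H₂ γ s (by linarith) hs' him (by linarith)
  have hle : ‖factorNum χ s‖ / ‖factorDen χ s‖ ≤
      (C₁ ^ 2 * C₂) * d ^ (2 : ℝ) * (1 + |γ|) ^ (4 * (c + η) + 3 * η) := by
    rw [factorNum, norm_mul, norm_pow, div_eq_mul_inv, mul_assoc]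
    calc _ ≤ (C₁ * d * (1 + |γ|) ^ (2 * (c + η))) ^ 2 * (C₂ * (1 + |γ|) ^ (3 * η)) := by gcongr
      _ = _ := by
        rw [Real.rpow_add hA, show 4 * (c + η) = 2 * (c + η) + 2 * (c + η) by ring,
          Real.rpow_add hA, Real.rpow_two]
        ring
  rw [absF]
  calc _ ≤ ((C₁ ^ 2 * C₂) * d ^ (2 : ℝ) * (1 + |γ|) ^ (4 * (c + η) + 3 * η)) ^ (1 / 4 : ℝ) :=
        Real.rpow_le_rpow (by positivity) hle (by norm_num)
    _ = (C₁ ^ 2 * C₂) ^ (1 / 4 : ℝ) * d ^ (1 / 2 : ℝ) *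
        (1 + |γ|) ^ ((4 * (c + η) + 3 * η) * (1 / 4)) := by
      rw [Real.mul_rpow (by positivity) (by positivity), Real.mul_rpow (by positivity)
        (by positivity), ← Real.rpow_mul hd0, ← Real.rpow_mul hA.le]
      norm_num
    _ ≤ _ := by
      gcongr
      · linarith [abs_nonneg γ]
      · linarith

end

/-- If `g` agrees near the contour, and off the horizontal line through `ρ`, with a function `G`
that is continuous up to that line, then the boundary values in the Hankel integral are those
of `G`. -/
theorem hankelAbsIntegral_eq {g G : ℂ → ℝ} {ρ : ℂ} {c r δ M : ℝ} (hrc : r ≤ c) (hδ : 0 < δ)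
    (hG : ∀ s : ℂ, ρ.re - c ≤ s.re → s.re ≤ ρ.re - r → |s.im - ρ.im| < δ →
      ContinuousAt G s ∧ |G s| ≤ M)
    (hgG : ∀ s : ℂ, ρ.re - c ≤ s.re → s.re ≤ ρ.re - r → |s.im - ρ.im| < δ → s.im ≠ ρ.im →
      g s = G s) :
    hankelAbsIntegral g ρ c r = 2 * (∫ σ in (ρ.re - c)..(ρ.re - r), G (σ + ρ.im * I)) +
      ∫ θ in (-Real.pi)..Real.pi, g (ρ + r * Complex.exp (θ * I)) * r := by
  have hab : ρ.re - c ≤ ρ.re - r := by linarith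
  have key : ∀ u : ℝ → ℝ, Tendsto u (nhdsWithin 0 (Set.Ioi 0)) (nhds 0) →
      (∀ᶠ e in nhdsWithin (0 : ℝ) (Set.Ioi 0), u e ≠ 0) →
      Tendsto (fun e => ∫ σ in (ρ.re - c)..(ρ.re - r), g (σ + (ρ.im + u e : ℝ) * I))
        (nhdsWithin 0 (Set.Ioi 0)) (nhds (∫ σ in (ρ.re - c)..(ρ.re - r), G (σ + ρ.im * I))) := by
    intro u hu hu0
    have huδ : ∀ᶠ e in nhdsWithin (0 : ℝ) (Set.Ioi 0), |u e| < δ :=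
      hu.abs.eventually_lt_const (by simpa using hδ)
    have heq : ∀ᶠ e in nhdsWithin (0 : ℝ) (Set.Ioi 0),
        ∫ σ in (ρ.re - c)..(ρ.re - r), G (σ + (ρ.im + u e : ℝ) * I) =
          ∫ σ in (ρ.re - c)..(ρ.re - r), g (σ + (ρ.im + u e : ℝ) * I) := by
      filter_upwards [hu0, huδ] with e he0 heδ
      refine intervalIntegral.integral_congr fun σ hσ => ?_
      rw [Set.uIcc_of_le hab] at hσ
      exact (hgG _ (by simpa using hσ.1) (by simpa using hσ.2) (by simpa using heδ)
        (by simpa using he0)).symm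
    refine Tendsto.congr' heq ?_
    refine intervalIntegral.tendsto_integral_filter_of_dominated_convergence (fun _ => M) ?_ ?_
      intervalIntegrable_const ?_
    · filter_upwards [huδ] with e heδ
      rw [Set.uIoc_of_le hab]
      refine ContinuousOn.aestronglyMeasurable (fun σ hσ => ?_) measurableSet_Ioc
      refine ((hG (σ + (ρ.im + u e : ℝ) * I) (by simpa using hσ.1.le) (by simpa using hσ.2)
        (by simpa using heδ)).1.comp (f := fun σ : ℝ => (σ + (ρ.im + u e : ℝ) * I : ℂ))
        (by fun_prop)).continuousWithinAt
    · filter_upwards [huδ] with e heδ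
      refine Eventually.of_forall fun σ hσ => ?_
      rw [Set.uIoc_of_le hab] at hσ
      exact (hG (σ + (ρ.im + u e : ℝ) * I) (by simpa using hσ.1.le) (by simpa using hσ.2)
        (by simpa using heδ)).2
    · refine Eventually.of_forall fun σ hσ => ?_
      rw [Set.uIoc_of_le hab] at hσ
      have hc := (hG (σ + ρ.im * I) (by simpa using hσ.1.le) (by simpa using hσ.2)
        (by simpa using hδ)).1
      refine hc.tendsto.comp ?_
      have h1 : Tendsto (fun e => ρ.im + u e) (nhdsWithin 0 (Set.Ioi 0)) (nhds ρ.im) := by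
        simpa using hu.const_add ρ.im
      exact (((continuous_ofReal.tendsto _).comp h1).mul_const I).const_add _
  have hid : Tendsto (fun e : ℝ => e) (nhdsWithin 0 (Set.Ioi 0)) (nhds 0) := nhdsWithin_le_nhds
  have hne : ∀ᶠ e in nhdsWithin (0 : ℝ) (Set.Ioi 0), e ≠ 0 := by
    filter_upwards [self_mem_nhdsWithin] with e he
    exact (Set.mem_Ioi.1 he).ne'
  have hlow := key (fun e => -e) (by simpa using hid.neg) (hne.mono fun e he => neg_ne_zero.2 he)
  have hup := key (fun e => e) hid hne
  rw [hankelAbsIntegral, two_mul, add_right_comm]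
  refine Tendsto.limUnder_eq ?_
  have := (hlow.add_const (∫ θ in (-Real.pi)..Real.pi, g (ρ + r * Complex.exp (θ * I)) * r)).add hup
  simpa only [← sub_eq_add_neg, ofReal_sub, ofReal_add] using this

theorem integral_sqrt_mul_rpow_le {c r x : ℝ} (hr : 0 < r) (hrc : r ≤ c) (hx : 1 < x) :
    ∫ σ in (1 / 2 - c)..(1 / 2 - r), (1 / 2 - σ) ^ (1 / 2 : ℝ) * x ^ σ ≤
      Real.sqrt x * (Real.Gamma (3 / 2) * Real.log x ^ (-(3 : ℝ) / 2)) := by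
  have hx0 : 0 < x := by linarith
  have hlog : 0 < Real.log x := Real.log_pos hx
  set f : ℝ → ℝ := fun u => Real.sqrt x * (u ^ (3 / 2 - 1 : ℝ) * Real.exp (-(Real.log x * u)))
    with hf
  have h1 : ∀ σ : ℝ, (1 / 2 - σ) ^ (1 / 2 : ℝ) * x ^ σ = f (1 / 2 - σ) := by
    intro σ
    have : x ^ σ = Real.sqrt x * Real.exp (-(Real.log x * (1 / 2 - σ))) := by
      rw [Real.sqrt_eq_rpow, Real.rpow_def_of_pos hx0, Real.rpow_def_of_pos hx0, ← Real.exp_add]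
      ring_nf
    simp only [this, hf]
    norm_num
    ring
  have hf_int : MeasureTheory.IntegrableOn
      (fun u : ℝ => u ^ (3 / 2 - 1 : ℝ) * Real.exp (-(Real.log x * u))) (Set.Ioi 0) := by
    have := integrableOn_rpow_mul_exp_neg_mul_rpow (p := 1) (s := (3 / 2 - 1 : ℝ)) (by norm_num)
      one_pos hlog
    simpa only [Real.rpow_one, neg_mul] using this
  rw [(intervalIntegral.integral_congr fun σ _ => h1 σ).trans
    (intervalIntegral.integral_comp_sub_left f _), hf, intervalIntegral.integral_const_mul]
  refine mul_le_mul_of_nonneg_left ?_ (Real.sqrt_nonneg x)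
  rw [sub_sub_cancel, sub_sub_cancel, intervalIntegral.integral_of_le hrc]
  have hnn : 0 ≤ᵐ[MeasureTheory.volume.restrict (Set.Ioi 0)]
      fun u : ℝ => u ^ (3 / 2 - 1 : ℝ) * Real.exp (-(Real.log x * u)) := by
    filter_upwards [MeasureTheory.ae_restrict_mem measurableSet_Ioi] with u hu
    have := Set.mem_Ioi.1 hu
    positivity
  refine (MeasureTheory.setIntegral_mono_set hf_int hnn
    (LE.le.eventuallyLE fun u hu => hr.trans hu.1)).trans ?_
  rw [Real.integral_rpow_mul_exp_neg_mul_Ioi (by norm_num) hlog, one_div, Real.inv_rpow hlog.le,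
    neg_div, Real.rpow_neg hlog.le, mul_comm]

theorem ae_sin_ne_zero : ∀ᵐ θ : ℝ, θ ∈ Set.uIoc (-Real.pi) Real.pi → θ ≠ 0 →
    Real.sin θ ≠ 0 := by
  filter_upwards [MeasureTheory.Measure.ae_ne MeasureTheory.volume Real.pi] with θ hθ hmem h0
  rw [Set.uIoc_of_le (by linarith [Real.pi_pos])] at hmem
  intro h
  rw [Real.sin_eq_zero_iff_of_lt_of_lt hmem.1 (lt_of_le_of_ne hmem.2 hθ)] at h
  exact h0 h

theorem hankelAbsIntegral_le {g G : ℂ → ℝ} {ρ : ℂ} {K c r x δ : ℝ} (hρ : ρ.re = 1 / 2)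
    (hK : 0 ≤ K) (hx : 1 < x) (hr : 0 < r) (hrc : r ≤ c) (hrδ : r < δ)
    (hG : ∀ s : ℂ, 1 / 2 - c ≤ s.re → s.re ≤ 1 / 2 + r → |s.im - ρ.im| < δ →
      ContinuousAt G s ∧ 0 ≤ G s ∧ G s ≤ K * ‖s - ρ‖ ^ (1 / 2 : ℝ) * x ^ s.re)
    (hgG : ∀ s : ℂ, 1 / 2 - c ≤ s.re → s.re ≤ 1 / 2 + r → |s.im - ρ.im| < δ →
      (s.im ≠ ρ.im ∨ 1 / 2 < s.re) → g s = G s) :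
    hankelAbsIntegral g ρ c r ≤ K * (2 * Real.Gamma (3 / 2) + 2 * Real.pi) * Real.sqrt x *
      (Real.log x ^ (-(3 : ℝ) / 2) + r ^ ((3 : ℝ) / 2) * x ^ r) := by
  have hx0 : 0 < x := by linarith
  have hδ : 0 < δ := hr.trans hrδ
  have hlog : 0 < Real.log x := Real.log_pos hx
  have hΓ : 0 < Real.Gamma (3 / 2) := Real.Gamma_pos_of_pos (by norm_num)
  have hπ := Real.pi_pos
  have hM : ∀ s : ℂ, ρ.re - c ≤ s.re → s.re ≤ ρ.re - r → |s.im - ρ.im| < δ →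
      ContinuousAt G s ∧ |G s| ≤ K * (c + δ) ^ (1 / 2 : ℝ) * x ^ (1 / 2 : ℝ) := by
    intro s hs hs' ht
    obtain ⟨hc, h0, hle⟩ := hG s (by linarith) (by linarith) ht
    refine ⟨hc, ?_⟩
    rw [abs_of_nonneg h0]
    refine hle.trans ?_
    have hn : ‖s - ρ‖ ≤ c + δ := by
      refine (norm_le_abs_re_add_abs_im _).trans (add_le_add ?_ ?_)
      · rw [sub_re, abs_le]
        constructor <;> linarith
      · rw [sub_im]
        exact ht.le
    have hcδ : 0 ≤ K * (c + δ) ^ (1 / 2 : ℝ) := by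
      have : 0 ≤ c + δ := by linarith
      positivity
    gcongr
    · exact hx.le
    · linarith
  rw [hankelAbsIntegral_eq hrc hδ hM fun s hs hs' ht h =>
    hgG s (by linarith) (by linarith) ht (Or.inl h), hρ]
  have hab : 1 / 2 - c ≤ 1 / 2 - r := by linarith
  have hseg : ∫ σ in (1 / 2 - c)..(1 / 2 - r), G (σ + ρ.im * I) ≤
      K * (Real.sqrt x * (Real.Gamma (3 / 2) * Real.log x ^ (-(3 : ℝ) / 2))) := by
    have hmono : ∫ σ in (1 / 2 - c)..(1 / 2 - r), G (σ + ρ.im * I) ≤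
        ∫ σ in (1 / 2 - c)..(1 / 2 - r), K * ((1 / 2 - σ) ^ (1 / 2 : ℝ) * x ^ σ) := by
      refine intervalIntegral.integral_mono_on hab ?_ ?_ fun σ hσ => ?_
      · refine ContinuousOn.intervalIntegrable fun σ hσ => ?_
        rw [Set.uIcc_of_le hab] at hσ
        refine ((hG (σ + ρ.im * I) (by simpa using hσ.1) (by simpa using by linarith [hσ.2])
          (by simpa using hδ)).1.comp (f := fun σ : ℝ => (σ + ρ.im * I : ℂ))
          (by fun_prop)).continuousWithinAt
      · refine Continuous.intervalIntegrable ?_ _ _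
        refine continuous_const.mul (Continuous.mul ?_ ?_)
        · exact (continuous_const.sub continuous_id).rpow_const fun _ => Or.inr (by norm_num)
        · exact continuous_const.rpow continuous_id fun _ => Or.inl hx0.ne'
      · have h := (hG (σ + ρ.im * I) (by simpa using hσ.1) (by simpa using by linarith [hσ.2])
          (by simpa using hδ)).2.2
        have hsub : (σ + ρ.im * I - ρ : ℂ) = ((σ - 1 / 2 : ℝ) : ℂ) := by
          apply Complex.ext <;> simp [hρ]
        rw [hsub, norm_real, Real.norm_eq_abs, abs_of_nonpos (by linarith [hσ.2]), neg_sub,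
          mul_assoc] at h
        simpa using h
    refine hmono.trans ?_
    rw [intervalIntegral.integral_const_mul]
    exact mul_le_mul_of_nonneg_left (integral_sqrt_mul_rpow_le hr hrc hx) hK
  have hcirc : ∫ θ in (-Real.pi)..Real.pi, g (ρ + r * Complex.exp (θ * I)) * r ≤
      K * r ^ (1 / 2 : ℝ) * x ^ (1 / 2 + r) * r * |Real.pi - -Real.pi| := by
    refine (Real.le_norm_self _).trans (intervalIntegral.norm_integral_le_of_norm_le_const_ae ?_)
    filter_upwards [ae_sin_ne_zero] with θ hθ hmem
    set s : ℂ := ρ + r * Complex.exp (θ * I) with hs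
    have hre : s.re = 1 / 2 + r * Real.cos θ := by
      rw [hs, add_re, re_ofReal_mul, exp_ofReal_mul_I_re, hρ]
    have him : s.im = ρ.im + r * Real.sin θ := by
      rw [hs, add_im, im_ofReal_mul, exp_ofReal_mul_I_im]
    have hnorm : ‖s - ρ‖ = r := by
      rw [hs, add_sub_cancel_left, norm_mul, norm_exp_ofReal_mul_I, mul_one, norm_real,
        Real.norm_eq_abs, abs_of_pos hr]
    have hre1 : 1 / 2 - c ≤ s.re := by nlinarith [Real.neg_one_le_cos θ]
    have hre2 : s.re ≤ 1 / 2 + r := by nlinarith [Real.cos_le_one θ]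
    have himδ : |s.im - ρ.im| < δ := by
      rw [him, add_sub_cancel_left, abs_mul, abs_of_pos hr]
      nlinarith [Real.abs_sin_le_one θ]
    have hoff : s.im ≠ ρ.im ∨ 1 / 2 < s.re := by
      by_cases h0 : θ = 0
      · right
        rw [hre, h0, Real.cos_zero]
        linarith
      · left
        rw [him]
        simpa using ⟨hr.ne', hθ hmem h0⟩
    obtain ⟨-, h0, hle⟩ := hG s hre1 hre2 himδ
    rw [hgG s hre1 hre2 himδ hoff, Real.norm_eq_abs, abs_of_nonneg (mul_nonneg h0 hr.le)]
    rw [hnorm] at hle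
    refine mul_le_mul_of_nonneg_right (hle.trans ?_) hr.le
    gcongr
    exact hx.le
  have e1 : r ^ (1 / 2 : ℝ) * r = r ^ ((3 : ℝ) / 2) := by
    rw [← Real.rpow_add_one hr.ne']
    norm_num
  have e2 : K * r ^ (1 / 2 : ℝ) * x ^ (1 / 2 + r) * r * |Real.pi - -Real.pi| =
      K * (2 * Real.pi) * Real.sqrt x * (r ^ ((3 : ℝ) / 2) * x ^ r) := by
    rw [sub_neg_eq_add, abs_of_pos (by linarith), ← e1, Real.rpow_add hx0, Real.sqrt_eq_rpow]
    ring
  rw [e2] at hcirc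
  set L := Real.log x ^ (-(3 : ℝ) / 2) with hL
  set R := r ^ ((3 : ℝ) / 2) * x ^ r with hR
  have hL0 : 0 ≤ L := by positivity
  have hR0 : 0 ≤ R := by positivity
  have p1 : 0 ≤ K * Real.sqrt x * (2 * Real.pi) * L := by positivity
  have p2 : 0 ≤ K * Real.sqrt x * (2 * Real.Gamma (3 / 2)) * R := by positivity
  linear_combination 2 * hseg + hcirc + p1 + p2

/-- **Lemma 4.2:** absolute-value bound for the Hankel loop integral of `F(s,χ) x^s`
around a non-trivial zero `ρ = 1/2 + iγ ≠ 1/2`. -/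
theorem hankel_abs_integral_bound
    (q : ℕ) (hq : 0 < q) (χ : DirichletCharacter ℂ q) (hχ : χ ≠ 1)
    (h1 : GRH χ) (h2 : GRH (mulChiNeg4 χ)) (h3 : GRH (χ ^ 2)) (h4 : GRH (mulChiNeg4 (χ ^ 2)))
    (c : ℝ) (hc0 : 0 < c) (hc1 : c < 1 / 8) (ε : ℝ) (hε : 0 < ε)
    (F : ℂ → ℂ)
    (hFser : ∀ s : ℂ, 1 < s.re → F s = LSeries (STwist χ) s)
    (hFan : DifferentiableOn ℂ F {s : ℂ | 1 / 4 < s.re ∧ (s.re ≤ 1 / 2 →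
      LVal χ (1 / 2 + s.im * I) * LVal (mulChiNeg4 χ) (1 / 2 + s.im * I) ≠ 0 ∧
      ¬(s.im = 0 ∧ (χ ^ 2 = 1 ∨ mulChiNeg4 (χ ^ 2) = 1)))}) :
    ∃ C : ℝ, ∀ γ : ℝ, γ ≠ 0 →
      LVal χ (1 / 2 + γ * I) * LVal (mulChiNeg4 χ) (1 / 2 + γ * I) = 0 →
      ∀ x : ℝ, 2 ≤ x → ∃ r₀ : ℝ, 0 < r₀ ∧ ∀ r : ℝ, 0 < r → r < r₀ →
        hankelAbsIntegral (fun s => ‖F s‖ * x ^ s.re) (1 / 2 + γ * I) c r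
          ≤ C * Real.sqrt x * (|γ| + 1) ^ (c + ε) *
            (Real.log x ^ (-(3 : ℝ) / 2) + r ^ ((3 : ℝ) / 2) * x ^ r) := by
  have : NeZero q := ⟨hq.ne'⟩
  obtain ⟨δ₀, hδ₀, H₀⟩ := exists_LProd_half_ne_zero h1 h2 0
  obtain ⟨κ, hκ0, hκc, hκδ⟩ : ∃ κ, 0 < κ ∧ κ ≤ c ∧ 2 * κ ≤ δ₀ :=
    ⟨min c (δ₀ / 2), by positivity, min_le_left _ _, by linarith [min_le_right c (δ₀ / 2)]⟩
  obtain ⟨C, hC, H⟩ := exists_absF_le h1 h2 h3 h4 hκ0 hκc hc1 hε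
  refine ⟨C * (2 * Real.Gamma (3 / 2) + 2 * Real.pi), fun γ hγ hzero x hx => ?_⟩
  have hγκ : 2 * κ ≤ |γ| := by
    by_contra! h
    exact H₀ γ hγ (by rw [sub_zero]; linarith) hzero
  obtain ⟨δ, hδ, Hδ⟩ := exists_LProd_half_ne_zero h1 h2 γ
  refine ⟨min κ δ, lt_min hκ0 hδ, fun r hr hrr => ?_⟩
  have hrκ : r < κ := hrr.trans_le (min_le_left _ _)
  have hρre : (1 / 2 + γ * I : ℂ).re = 1 / 2 := by simp
  have hρim : (1 / 2 + γ * I : ℂ).im = γ := by simp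
  have him : ∀ s : ℂ, |s.im - γ| < min κ δ → s.im ≠ 0 := fun s hs h0 => by
    have := hs.trans_le (min_le_left _ _)
    rw [h0, zero_sub, abs_neg] at this
    linarith
  have key := hankelAbsIntegral_le (g := fun s => ‖F s‖ * x ^ s.re)
    (G := fun s => absF χ s * x ^ s.re) (K := C * (1 + |γ|) ^ (c + ε)) hρre (by positivity)
    (by linarith : 1 < x) hr (by linarith : r ≤ c) hrr ?_ ?_
  · refine key.trans_eq ?_
    rw [add_comm 1 |γ|]
    ring
  · intro s hs hs' ht
    rw [hρim] at ht
    have hnn : 0 ≤ absF χ s := by rw [absF]; positivity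
    refine ⟨?_, by positivity, ?_⟩
    · exact (continuousAt_absF h4 (by linarith) (him s ht)).mul
        (continuousAt_const.rpow continuous_re.continuousAt (Or.inl (by linarith)))
    · have := H γ s hγκ hzero hs (by linarith) (ht.le.trans (min_le_left _ _))
      refine (mul_le_mul_of_nonneg_right this (by positivity)).trans_eq ?_
      ring
  · intro s hs hs' ht hoff
    rw [hρim] at ht hoff
    have : ‖F s‖ = absF χ s := by
      refine norm_eq_absF h4 hFser hFan (by linarith) (him s ht) fun hre => ?_
      refine Hδ _ (hoff.resolve_right (by linarith)) (ht.trans_le (min_le_right _ _))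
    simp only [this]

end
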